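/- arXiv:2101.12353 — 3 statements merged into one kernel-verified Lean document; each statement's English description precedes it below -/
import Mathlib

section
/- Let $p \in [1,\infty)$ and let $\nu$ be an absolutely continuous probability distribution on $\mathbb{R}$. Assume $\mu$ is a probability distribution on $\mathbb{R}^d$ with finite absolute $q$-moment $M_q(\mu) < \infty$ for some $q > p$. Then there exists a constant $C$ depending only on $p$, $q$ and $d$ such that for all integers $W \ge 7d+1$ and $L \ge 2$: if $q > p + p/d$ then $\inf_{\phi \in \mathcal{NN}(W,L)} W_p(\mu, \phi_\# \nu) \le C (M_q^q(\mu)+1)^{1/p} (W^2 L)^{-1/d}$, and if $p < q \le p + p/d$ then $\inf_{\phi \in \mathcal{NN}(W,L)} W_p(\mu, \phi_\# \nu) \le C (M_q^q(\mu)+1)^{1/p} (W^2 L)^{-1/d} (\log_2 (W^2 L))^{1/d}$. -/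
open MeasureTheory Filter Topology Metric Set
open scoped ENNReal NNReal

noncomputable section

/-! ### ReLU neural networks -/

/-- Forward pass of a ReLU network: `nnForward N M b l x` is the output of the `l`-th hidden
layer (after applying the ReLU) on input `x`. Here `N l` is the number of neurons in layer `l`,
`M l` and `b l` are the weight matrix and the bias vector of the affine map `A_l`. -/
def nnForward (N : ℕ → ℕ)
    (M : ∀ l : ℕ, Matrix (Fin (N (l + 1))) (Fin (N l)) ℝ)
    (b : ∀ l : ℕ, Fin (N (l + 1)) → ℝ) :
    ∀ l : ℕ, (Fin (N 0) → ℝ) → Fin (N l) → ℝ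
  | 0 => fun x => x
  | l + 1 => fun x i => max ((M l).mulVec (nnForward N M b l x) i + b l i) 0

/-- `NNset m d W L` is the set of functions `ℝ^m → ℝ^d` that are representable by ReLU neural
networks with width at most `W` and depth (number of hidden layers) at most `L`. -/
def NNset (m d W L : ℕ) : Set (EuclideanSpace ℝ (Fin m) → EuclideanSpace ℝ (Fin d)) :=
  {φ | ∃ L' : ℕ, 1 ≤ L' ∧ L' ≤ L ∧
    ∃ (N : ℕ → ℕ) (h0 : N 0 = m) (hL : N (L' + 1) = d),
      (∀ l, 1 ≤ l → l ≤ L' → N l ≤ W) ∧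
      ∃ (M : ∀ l : ℕ, Matrix (Fin (N (l + 1))) (Fin (N l)) ℝ)
        (b : ∀ l : ℕ, Fin (N (l + 1)) → ℝ),
        ∀ (x : EuclideanSpace ℝ (Fin m)) (i : Fin d),
          φ x i = (M L').mulVec (nnForward N M b L' (fun j => x (Fin.cast h0 j)))
              (Fin.cast hL.symm i) + b L' (Fin.cast hL.symm i)}

/-- ReLU networks with one-dimensional input, viewed as functions on `ℝ`. -/
def NNset1 (d W L : ℕ) : Set (ℝ → EuclideanSpace ℝ (Fin d)) :=
  {φ | (fun x : EuclideanSpace ℝ (Fin 1) => φ (x 0)) ∈ NNset 1 d W L}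

/-! ### Wasserstein distances -/

/-- `WppENN p μ ν` is the `p`-th power of the `p`-th Wasserstein distance, i.e. the optimal
transportation cost `inf_γ ∫ dist(x,y)^p dγ` over all couplings `γ` of `μ` and `ν`. -/
def WppENN {E : Type*} [MeasurableSpace E] [PseudoEMetricSpace E] (p : ℝ)
    (μ ν : Measure E) : ℝ≥0∞ :=
  ⨅ (γ : Measure (E × E)) (_ : γ.map Prod.fst = μ ∧ γ.map Prod.snd = ν),
    ∫⁻ z, edist z.1 z.2 ^ p ∂γ

/-- The `p`-th Wasserstein distance `W_p(μ,ν)` (valued in `ℝ≥0∞`). -/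
def Wdist {E : Type*} [MeasurableSpace E] [PseudoEMetricSpace E] (p : ℝ)
    (μ ν : Measure E) : ℝ≥0∞ :=
  WppENN p μ ν ^ (1 / p)

/-- `𝒫(n)`: the set of discrete probability measures on `ℝ^d` supported on at most `n` points. -/
def discreteP (d n : ℕ) : Set (Measure (EuclideanSpace ℝ (Fin d))) :=
  {μ | ∃ (x : Fin n → EuclideanSpace ℝ (Fin d)) (w : Fin n → ℝ≥0∞),
    ∑ i, w i = 1 ∧ μ = ∑ i, w i • Measure.dirac (x i)}

/-- The `q`-th absolute moment `M_q^q(μ) = ∫ |x|^q dμ(x)` (valued in `ℝ≥0∞`). -/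
def moment (q : ℝ) {d : ℕ} (μ : Measure (EuclideanSpace ℝ (Fin d))) : ℝ≥0∞ :=
  ∫⁻ x, ENNReal.ofReal ‖x‖ ^ q ∂μ

/-- `M_q(μ) = (∫ |x|^q dμ(x))^{1/q}` as a real number (junk value if the moment is infinite). -/
def Mq (q : ℝ) {d : ℕ} (μ : Measure (EuclideanSpace ℝ (Fin d))) : ℝ :=
  (moment q μ).toReal ^ (1 / q)

/-! ### Covering numbers and dimensions -/

/-- The `ε`-covering number of a set `S`: the smallest number of open balls of radius `ε`
needed to cover `S` (`⊤` if no finite cover exists). -/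
def coveringNumber {E : Type*} [PseudoMetricSpace E] (ε : ℝ) (S : Set E) : ℕ∞ :=
  ⨅ (t : Finset E) (_ : S ⊆ ⋃ x ∈ t, Metric.ball x ε), (t.card : ℕ∞)

/-- The `(ε,δ)`-covering number of a measure `μ`:
`inf { N_ε(S) : μ(S) ≥ 1 - δ }`. -/
def measureCoveringNumber {E : Type*} [PseudoMetricSpace E] [MeasurableSpace E]
    (ε δ : ℝ) (μ : Measure E) : ℕ∞ :=
  ⨅ (S : Set E) (_ : 1 - ENNReal.ofReal δ ≤ μ S), coveringNumber ε S

/-- Base-2 logarithm of an extended natural number, valued in `ℝ≥0∞`. -/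
def elog2 (n : ℕ∞) : ℝ≥0∞ :=
  if n = ⊤ then ⊤ else ENNReal.ofReal (Real.logb 2 (n.toNat : ℝ))

/-- The upper dimension `d_r^*(μ) = limsup_{ε → 0} log₂ N_ε(μ, ε^r) / (-log₂ ε)`. -/
def upperDim {E : Type*} [PseudoMetricSpace E] [MeasurableSpace E] (r : ℝ)
    (μ : Measure E) : ℝ≥0∞ :=
  Filter.limsup
    (fun ε : ℝ => elog2 (measureCoveringNumber ε (ε ^ r) μ) / ENNReal.ofReal (-Real.logb 2 ε))
    (𝓝[>] (0 : ℝ))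

/-- The lower dimension `d_*(μ) = lim_{δ → 0} liminf_{ε → 0} log₂ N_ε(μ,δ) / (-log₂ ε)`;
since the inner quantity is antitone in `δ`, the limit as `δ → 0⁺` equals the supremum over
`δ > 0`. -/
def lowerDim {E : Type*} [PseudoMetricSpace E] [MeasurableSpace E] (μ : Measure E) : ℝ≥0∞ :=
  ⨆ (δ : ℝ) (_ : 0 < δ),
    Filter.liminf
      (fun ε : ℝ => elog2 (measureCoveringNumber ε δ μ) / ENNReal.ofReal (-Real.logb 2 ε))
      (𝓝[>] (0 : ℝ))

/-- The (upper) Minkowski dimension of a set, via covering numbers. -/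
def setDimM {E : Type*} [PseudoMetricSpace E] (S : Set E) : ℝ≥0∞ :=
  Filter.limsup
    (fun ε : ℝ => elog2 (coveringNumber ε S) / ENNReal.ofReal (-Real.logb 2 ε))
    (𝓝[>] (0 : ℝ))

/-- The Minkowski dimension of a measure: `inf { dim_M S : μ(S) = 1 }`. -/
def measureDimM {E : Type*} [PseudoMetricSpace E] [MeasurableSpace E]
    (μ : Measure E) : ℝ≥0∞ :=
  ⨅ (S : Set E) (_ : μ S = 1), setDimM S

/-- The Hausdorff dimension of a measure: `inf { dim_H S : μ(S) = 1 }`. -/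
def measureDimH {E : Type*} [EMetricSpace E] [MeasurableSpace E] (μ : Measure E) : ℝ≥0∞ :=
  ⨅ (S : Set E) (_ : μ S = 1), dimH S

/-- The support of a measure on a metric space: points all of whose balls have positive
measure. -/
def msupport {E : Type*} [PseudoMetricSpace E] [MeasurableSpace E] (μ : Measure E) : Set E :=
  {x | ∀ ε : ℝ, 0 < ε → 0 < μ (Metric.ball x ε)}

/-! ### f-divergences -/

/-- Conversion `EReal → ℝ≥0∞` (negative values go to `0`). -/
def erealToENNReal (x : EReal) : ℝ≥0∞ :=
  if x = ⊤ then ⊤ else ENNReal.ofReal x.toReal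

/-- Integral of an `EReal`-valued function: difference of the lower integrals of the positive
and negative parts. -/
def eintegral {α : Type*} [MeasurableSpace α] (μ : Measure α) (g : α → EReal) : EReal :=
  ((∫⁻ x, erealToENNReal (g x) ∂μ : ℝ≥0∞) : EReal)
    - ((∫⁻ x, erealToENNReal (-(g x)) ∂μ : ℝ≥0∞) : EReal)

/-- `f(0) := lim_{t ↓ 0} f(t)` (as an `EReal`; realized as a `limsup`, which agrees with the
limit whenever the limit exists, e.g. for convex `f`). -/
def limZero (f : ℝ → ℝ) : EReal :=
  Filter.limsup (fun t : ℝ => ((f t : ℝ) : EReal)) (𝓝[>] (0 : ℝ))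

/-- `f^*(0) := lim_{t → ∞} f(t)/t` (as an `EReal`; realized as a `limsup`). -/
def limInfty (f : ℝ → ℝ) : EReal :=
  Filter.limsup (fun t : ℝ => ((f t / t : ℝ) : EReal)) Filter.atTop

/-- The `f`-divergence `D_f(μ ‖ ν)`, defined through the reference measure `τ = μ + ν` with
densities `p = dμ/dτ`, `q = dν/dτ`:
`D_f(μ‖ν) = ∫_{q > 0} f(p/q) q dτ + f^*(0) μ({q = 0})`,
with the conventions `f(0) = lim_{t↓0} f t` on `{p = 0, q > 0}`. -/
def fDiv (f : ℝ → ℝ) {α : Type*} [MeasurableSpace α] (μ ν : Measure α) : EReal :=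
  eintegral ((μ + ν).restrict {x | ν.rnDeriv (μ + ν) x ≠ 0})
    (fun x =>
      if μ.rnDeriv (μ + ν) x = 0 then
        limZero f * (((ν.rnDeriv (μ + ν) x).toReal : ℝ) : EReal)
      else
        ((f ((μ.rnDeriv (μ + ν) x / ν.rnDeriv (μ + ν) x).toReal)
            * (ν.rnDeriv (μ + ν) x).toReal : ℝ) : EReal))
  + limInfty f * ((μ {x | ν.rnDeriv (μ + ν) x = 0} : ℝ≥0∞) : EReal)

/-! ### Piecewise linear functions -/

/-- The space `𝒮^d(z_0, …, z_{N+1})` of continuous piecewise linear functions `ℝ → ℝ^d` with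
breakpoints only at `z_0 < … < z_{N+1}`, constant on `(-∞, z_0)` and `(z_{N+1}, ∞)`. -/
def SpaceS (d N : ℕ) (z : Fin (N + 2) → ℝ) : Set (ℝ → EuclideanSpace ℝ (Fin d)) :=
  {φ | Continuous φ ∧
    (∀ x ≤ z 0, φ x = φ (z 0)) ∧
    (∀ x, z (Fin.last (N + 1)) ≤ x → φ x = φ (z (Fin.last (N + 1)))) ∧
    (∀ i : Fin (N + 1), ∃ a b : EuclideanSpace ℝ (Fin d),
      ∀ x ∈ Set.Icc (z i.castSucc) (z i.succ), φ x = x • a + b)}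

/-- A continuous piecewise linear function `ℝ → ℝ^d`. -/
def IsCPwL {d : ℕ} (φ : ℝ → EuclideanSpace ℝ (Fin d)) : Prop :=
  Continuous φ ∧ ∃ (k : ℕ) (z : Fin (k + 1) → ℝ), Monotone z ∧
    (∃ a b : EuclideanSpace ℝ (Fin d), ∀ x ∈ Set.Iic (z 0), φ x = x • a + b) ∧
    (∀ i : Fin k, ∃ a b : EuclideanSpace ℝ (Fin d),
      ∀ x ∈ Set.Icc (z i.castSucc) (z i.succ), φ x = x • a + b) ∧
    (∃ a b : EuclideanSpace ℝ (Fin d), ∀ x ∈ Set.Ici (z (Fin.last k)), φ x = x • a + b)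

end

lemma EuclideanSpace.norm_le_sum {d : ℕ} (v : EuclideanSpace ℝ (Fin d)) : ‖v‖ ≤ ∑ i, |v i| := by
  rw [EuclideanSpace.norm_eq]
  exact Real.sqrt_le_iff.2 ⟨Finset.sum_nonneg fun i _ => abs_nonneg _,
    Finset.sum_sq_le_sq_sum_of_nonneg fun i _ => abs_nonneg _⟩

/-- A forward pass with coefficients indexed by natural numbers: every layer `l ≥ 1` has width `W`,
the input layer has width one. -/
def reluForward (W : ℕ) (a : ℕ → ℕ → ℕ → ℝ) (b : ℕ → ℕ → ℝ) : ℕ → ℝ → ℕ → ℝ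
  | 0 => fun x _ => x
  | l + 1 => fun x i =>
      max (∑ j ∈ Finset.range (if l = 0 then 1 else W), a l i j * reluForward W a b l x j + b l i) 0

/-- `ReLULayer W l V` says that `V` is the space of affine combinations of the neurons of the `l`-th
hidden layer of some ReLU network on `ℝ` all of whose hidden layers have width `W`. -/
inductive ReLULayer (W : ℕ) : ℕ → Submodule ℝ (ℝ → ℝ) → Prop
  | input : ReLULayer W 0 (Submodule.span ℝ {1, id})
  | hidden {l : ℕ} {V : Submodule ℝ (ℝ → ℝ)} (hV : ReLULayer W l V) (k : Fin W → ℝ → ℝ)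
      (hk : ∀ i, k i ∈ V) :
      ReLULayer W (l + 1) (Submodule.span ℝ (insert 1 (Set.range fun i x => max (k i x) 0)))

lemma reluForward_congr {W n : ℕ} {a a' : ℕ → ℕ → ℕ → ℝ} {b b' : ℕ → ℕ → ℝ}
    (ha : ∀ l < n, a l = a' l) (hb : ∀ l < n, b l = b' l) :
    reluForward W a b n = reluForward W a' b' n := by
  induction n with
  | zero => rfl
  | succ n ih =>
    funext x i
    simp only [reluForward]
    rw [ih (fun l hl => ha l (by omega)) (fun l hl => hb l (by omega)), ha n (by omega),
      hb n (by omega)]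

/-- Affine combinations of the neurons of a layer can be written with explicit coefficients. -/
lemma ReLULayer.exists_coeff {W l : ℕ} {V : Submodule ℝ (ℝ → ℝ)} (h : ReLULayer W l V) :
    ∃ (a : ℕ → ℕ → ℕ → ℝ) (b : ℕ → ℕ → ℝ), ∀ f ∈ V, ∃ (α : ℕ → ℝ) (β : ℝ), ∀ x,
      f x = ∑ j ∈ Finset.range (if l = 0 then 1 else W), α j * reluForward W a b l x j + β := by
  induction h with
  | input =>
    refine ⟨0, 0, fun f hf => ?_⟩
    obtain ⟨s, t, rfl⟩ := Submodule.mem_span_pair.1 hf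
    refine ⟨fun _ => t, s, fun x => ?_⟩
    simp [reluForward, add_comm]
  | @hidden l V hV k hk ih =>
    obtain ⟨a, b, hab⟩ := ih
    choose α β hαβ using fun i => hab (k i) (hk i)
    set a' : ℕ → ℕ → ℕ → ℝ :=
      Function.update a l fun i j => if h : i < W then α ⟨i, h⟩ j else 0 with ha'
    set b' : ℕ → ℕ → ℝ :=
      Function.update b l fun i => if h : i < W then β ⟨i, h⟩ else 0 with hb'
    have hcongr : reluForward W a' b' l = reluForward W a b l :=
      reluForward_congr (fun i hi => by rw [ha', Function.update_of_ne hi.ne])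
        (fun i hi => by rw [hb', Function.update_of_ne hi.ne])
    have hneuron : ∀ (i : Fin W) x, reluForward W a' b' (l + 1) x i = max (k i x) 0 := by
      intro i x
      simp only [reluForward, hcongr]
      simp [ha', hb', hαβ i x]
    refine ⟨a', b', fun f hf => ?_⟩
    obtain ⟨s, g, hg, rfl⟩ := Submodule.mem_span_insert.1 hf
    obtain ⟨c, rfl⟩ := (Submodule.mem_span_range_iff_exists_fun ℝ).1 hg
    refine ⟨fun j => if h : j < W then c ⟨j, h⟩ else 0, s, fun x => ?_⟩
    rw [if_neg (Nat.succ_ne_zero l), Finset.sum_range]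
    simp [hneuron, add_comm]

/-- Vectors of functions from the last layer are realized by a ReLU network. -/
lemma ReLULayer.mem_NNset1 {W L L' d : ℕ} {V : Submodule ℝ (ℝ → ℝ)} (h : ReLULayer W L' V)
    (h1 : 1 ≤ L') (hL : L' ≤ L) {f : Fin d → ℝ → ℝ} (hf : ∀ c, f c ∈ V) :
    (fun x => WithLp.toLp 2 fun c => f c x) ∈ NNset1 d W L := by
  obtain ⟨a, b, hab⟩ := h.exists_coeff
  choose α β hαβ using fun c => hab (f c) (hf c)
  set a' : ℕ → ℕ → ℕ → ℝ :=
    Function.update a L' fun i j => if h : i < d then α ⟨i, h⟩ j else 0 with ha'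
  set b' : ℕ → ℕ → ℝ :=
    Function.update b L' fun i => if h : i < d then β ⟨i, h⟩ else 0 with hb'
  let N : ℕ → ℕ := fun l => if l = 0 then 1 else if l ≤ L' then W else d
  have hN : ∀ l ≤ L', N l = if l = 0 then 1 else W := by
    intro l hl
    simp [N, hl]
  have hfwd : ∀ l ≤ L', ∀ (x : Fin (N 0) → ℝ) (i : Fin (N l)),
      nnForward N (fun l i j => a' l i j) (fun l i => b' l i) l x i
        = reluForward W a b l (x ⟨0, by simp [N]⟩) i := by
    intro l
    induction l with
    | zero =>
      intro _ x i
      have : i = ⟨0, by simp [N]⟩ := Fin.ext (Nat.lt_one_iff.1 i.2)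
      subst this
      rfl
    | succ l ih =>
      intro hl x i
      simp only [nnForward, reluForward, Matrix.mulVec, dotProduct]
      rw [← hN l (by omega), Finset.sum_range]
      simp only [ih (by omega)]
      rw [ha', hb', Function.update_of_ne (by omega), Function.update_of_ne (by omega)]
  refine ⟨L', h1, hL, N, by simp [N], by simp [N], fun l hl hl' => ?_, fun l i j => a' l i j,
    fun l i => b' l i, fun x i => ?_⟩
  · simp [N, hl', Nat.one_le_iff_ne_zero.1 hl]
  · simp only [Matrix.mulVec, dotProduct, hfwd L' le_rfl]
    have := hαβ i (x 0)
    rw [← hN L' le_rfl, Finset.sum_range] at this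
    simpa [ha', hb'] using this

lemma ReLULayer.one_mem {W l : ℕ} {V : Submodule ℝ (ℝ → ℝ)} (h : ReLULayer W l V) :
    (1 : ℝ → ℝ) ∈ V := by
  cases h <;> exact Submodule.subset_span (Set.mem_insert _ _)

lemma ReLULayer.continuous {W l : ℕ} {V : Submodule ℝ (ℝ → ℝ)} (h : ReLULayer W l V) :
    ∀ f ∈ V, Continuous f := by
  have key : ∀ s : Set (ℝ → ℝ), (∀ f ∈ s, Continuous f) →
      ∀ f ∈ Submodule.span ℝ s, Continuous f := fun s hs f hf =>
    Submodule.span_induction (p := fun f _ => Continuous f) hs continuous_const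
      (fun _ _ _ _ h₁ h₂ => h₁.add h₂) (fun c _ _ h₁ => h₁.const_smul c) hf
  induction h with
  | input =>
    refine key _ ?_
    rintro f (rfl | rfl)
    exacts [continuous_const, continuous_id]
  | hidden hV k hk ih =>
    refine key _ ?_
    rintro f (rfl | ⟨i, rfl⟩)
    exacts [continuous_const, (ih _ (hk i)).max continuous_const]

/-- A layer may hold any family of at most `W` neurons. -/
lemma ReLULayer.exists_succ {W l : ℕ} {V : Submodule ℝ (ℝ → ℝ)} (h : ReLULayer W l V)
    {ι : Type*} [Fintype ι] (hι : Fintype.card ι ≤ W) (k : ι → ℝ → ℝ) (hk : ∀ i, k i ∈ V) :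
    ∃ V', ReLULayer W (l + 1) V' ∧ ∀ i, (fun x => max (k i x) 0) ∈ V' := by
  obtain ⟨e⟩ : Nonempty (ι ↪ Fin W) := Function.Embedding.nonempty_of_card_le (by simpa using hι)
  let k' : Fin W → ℝ → ℝ := Function.extend e k 0
  refine ⟨_, h.hidden k' fun i => ?_, fun i => ?_⟩
  · by_cases hi : ∃ j, e j = i
    · obtain ⟨j, rfl⟩ := hi
      simpa [k', e.injective.extend_apply] using hk j
    · simp only [k', Function.extend_apply' _ _ _ hi]
      exact V.zero_mem
  · refine Submodule.subset_span (Set.mem_insert_of_mem _ ⟨e i, ?_⟩)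
    simp [k', e.injective.extend_apply]

lemma Submodule.mem_of_relu_mem {V : Submodule ℝ (ℝ → ℝ)} {f : ℝ → ℝ}
    (hpos : (fun x => max (f x) 0) ∈ V) (hneg : (fun x => max (-f x) 0) ∈ V) : f ∈ V := by
  convert V.sub_mem hpos hneg using 1
  funext x
  rcases le_total 0 (f x) with h | h <;> simp [h]

/-- A continuous ramp that vanishes left of `s` and equals one right of `s + η`. -/
noncomputable def softStep (η s : ℝ) (x : ℝ) : ℝ := η⁻¹ * (max (x - s) 0 - max (x - s - η) 0)

lemma softStep_of_le {η s x : ℝ} (hη : 0 < η) (h : x ≤ s) : softStep η s x = 0 := by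
  rw [softStep, max_eq_right (by linarith), max_eq_right (by linarith)]
  simp

lemma softStep_of_ge {η s x : ℝ} (hη : 0 < η) (h : s + η ≤ x) : softStep η s x = 1 := by
  rw [softStep, max_eq_left (by linarith), max_eq_left (by linarith)]
  field_simp
  ring

lemma softStep_mem_Icc {η : ℝ} (hη : 0 < η) (s x : ℝ) : softStep η s x ∈ Set.Icc 0 1 := by
  rcases le_total x s with h | h
  · simp [softStep_of_le hη h]
  rcases le_total (s + η) x with h' | h'
  · simp [softStep_of_ge hη h']
  rw [softStep, max_eq_left (by linarith), max_eq_right (by linarith), sub_zero, Set.mem_Icc,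
    inv_mul_le_iff₀ hη]
  exact ⟨mul_nonneg (inv_nonneg.2 hη.le) (by linarith), by linarith⟩

/-- The switch `max u 0 - max (u - v) 0`: it equals `v` when `u` is large and `0` when `u` is very
negative. -/
noncomputable def reluSwitch (u v : ℝ) : ℝ := max u 0 - max (u - v) 0

lemma reluSwitch_of_le {u v : ℝ} (h : |v| ≤ u) : reluSwitch u v = v := by
  have := abs_le.1 h
  have := abs_nonneg v
  rw [reluSwitch, max_eq_left (by linarith), max_eq_left (by linarith)]
  ring

lemma reluSwitch_of_le_neg {u v : ℝ} (h : u ≤ -|v|) : reluSwitch u v = 0 := by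
  have := neg_abs_le v
  have := abs_nonneg v
  rw [reluSwitch, max_eq_right (by linarith), max_eq_right (by linarith)]
  ring

lemma reluSwitch_zero (u : ℝ) : reluSwitch u 0 = 0 := by simp [reluSwitch]

lemma abs_reluSwitch_le (u v : ℝ) : |reluSwitch u v| ≤ |v| := by
  simpa [reluSwitch] using abs_max_sub_max_le_abs u (u - v) 0

/-- A continuous version of the indicator of the block `(c (j * q), c ((j + 1) * q)]`. -/
noncomputable def softBlock (η : ℝ) (c : ℕ → ℝ) (q j : ℕ) (x : ℝ) : ℝ :=
  softStep η (c (j * q)) x - softStep η (c ((j + 1) * q)) x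

/-- A function that is close to `h j` on the `j`-th block, for the `m` blocks of the group `g`. -/
noncomputable def blockSum (η : ℝ) (c : ℕ → ℝ) (q m g : ℕ) (h : ℕ → ℝ) (x : ℝ) : ℝ :=
  ∑ j ∈ Finset.range m, h (g * m + j) * softBlock η c q (g * m + j) x

/-- The piecewise linear functions whose sign detects, on every block of the group `g`, the `r`-th
threshold of the block. -/
noncomputable def blockPhase (η K : ℝ) (c : ℕ → ℝ) (q m g r : ℕ) (x : ℝ) : ℝ :=
  K * (x - blockSum η c q m g (fun j => c (j * q + r) + η / 2) x)

/-- Near-jumps of size `a i` at the thresholds `c i` with index `i ≡ r` modulo `q` in the group `g`,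
undone at the end of each block. -/
noncomputable def blockJump (η K : ℝ) (c a : ℕ → ℝ) (q m g r : ℕ) (x : ℝ) : ℝ :=
  reluSwitch (blockPhase η K c q m g r x) (blockSum η c q m g (fun j => a (j * q + r)) x)

lemma abs_blockSum_le {η : ℝ} (hη : 0 < η) (c : ℕ → ℝ) (q m g : ℕ) {h : ℕ → ℝ} {A : ℝ}
    (hA : ∀ i < g * m + m, |h i| ≤ A) (x : ℝ) : |blockSum η c q m g h x| ≤ m * A := by
  refine (Finset.abs_sum_le_sum_abs _ _).trans ?_
  have : ∀ j ∈ Finset.range m, |h (g * m + j) * softBlock η c q (g * m + j) x| ≤ A := by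
    intro j hj
    have h1 := softStep_mem_Icc hη (c ((g * m + j) * q)) x
    have h2 := softStep_mem_Icc hη (c ((g * m + j + 1) * q)) x
    have h3 : |softBlock η c q (g * m + j) x| ≤ 1 := by
      rw [softBlock, abs_le]
      constructor <;> linarith [h1.1, h1.2, h2.1, h2.2]
    have h4 := hA (g * m + j) (by have := Finset.mem_range.1 hj; omega)
    rw [abs_mul]
    exact (mul_le_of_le_one_right (abs_nonneg _) h3).trans h4
  simpa using Finset.sum_le_sum this

section Evaluation

variable {η K : ℝ} {c : ℕ → ℝ} {q m j r : ℕ} {x : ℝ}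

lemma softBlock_eq (hη : 0 < η) (hc : Monotone c) (hx : c (j * q) + η ≤ x)
    (hx' : x ≤ c ((j + 1) * q)) (i : ℕ) : softBlock η c q i x = if i = j then 1 else 0 := by
  rcases lt_trichotomy i j with h | rfl | h
  · have h1 : c (i * q) ≤ c (j * q) := hc (Nat.mul_le_mul_right q h.le)
    have h2 : c ((i + 1) * q) ≤ c (j * q) := hc (Nat.mul_le_mul_right q h)
    rw [softBlock, softStep_of_ge hη (by linarith), softStep_of_ge hη (by linarith), if_neg h.ne,
      sub_self]
  · rw [softBlock, softStep_of_ge hη hx, softStep_of_le hη hx', if_pos rfl, sub_zero]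
  · have h1 : c ((j + 1) * q) ≤ c (i * q) := hc (Nat.mul_le_mul_right q h)
    have h2 : c ((j + 1) * q) ≤ c ((i + 1) * q) := hc (Nat.mul_le_mul_right q (by omega))
    rw [softBlock, softStep_of_le hη (by linarith), softStep_of_le hη (by linarith), if_neg h.ne',
      sub_self]

lemma blockSum_eq (hη : 0 < η) (hc : Monotone c) (hx : c (j * q) + η ≤ x)
    (hx' : x ≤ c ((j + 1) * q)) (hm : 0 < m) (g : ℕ) (h : ℕ → ℝ) :
    blockSum η c q m g h x = if g = j / m then h j else 0 := by
  simp only [blockSum, softBlock_eq hη hc hx hx', mul_ite, mul_one, mul_zero]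
  split_ifs with hg
  · have hj : g * m + j % m = j := by rw [hg]; exact Nat.div_add_mod' j m
    rw [Finset.sum_eq_single (j % m), if_pos hj, hj]
    · intro i _ hi
      rw [if_neg]
      omega
    · intro hi
      exact absurd (Finset.mem_range.2 (Nat.mod_lt j hm)) hi
  · refine Finset.sum_eq_zero fun i hi => if_neg fun h => hg ?_
    rw [← h, add_comm, Nat.add_mul_div_right _ _ hm, Nat.div_eq_of_lt (Finset.mem_range.1 hi),
      zero_add]

/-- On the good region of the `r`-th subinterval of the `j`-th block, the near-jumps are jumps. -/
lemma blockJump_eq (hη : 0 < η) (hc : Monotone c) {a : ℕ → ℝ} (hm : 0 < m) (hr : r < q)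
    (hx : c (j * q + r) + η ≤ x) (hx' : x ≤ c (j * q + r + 1))
    (hK : ∀ l < q, |a (j * q + l)| ≤ K * (η / 2)) (g l : ℕ) (hl : l < q) :
    blockJump η K c a q m g l x = if g = j / m ∧ l ≤ r then a (j * q + l) else 0 := by
  have h1 : c (j * q) + η ≤ x := le_trans (by gcongr; exact hc (by omega)) hx
  have h2 : x ≤ c ((j + 1) * q) := hx'.trans (hc (by rw [add_mul]; omega))
  have hK0 : 0 ≤ K := by
    have := (abs_nonneg _).trans (hK l hl)
    by_contra! h
    nlinarith
  rw [blockJump, blockPhase, blockSum_eq hη hc h1 h2 hm, blockSum_eq hη hc h1 h2 hm]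
  by_cases hg : g = j / m
  · simp only [hg, if_true, true_and]
    split_ifs with hlr
    · refine reluSwitch_of_le ((hK l hl).trans ?_)
      have : c (j * q + l) ≤ c (j * q + r) := hc (by omega)
      exact mul_le_mul_of_nonneg_left (by linarith) hK0
    · refine reluSwitch_of_le_neg ?_
      have : c (j * q + r + 1) ≤ c (j * q + l) := hc (by omega)
      have := mul_le_mul_of_nonneg_left (show η / 2 ≤ c (j * q + l) + η / 2 - x by linarith) hK0
      linarith [hK l hl]
  · simp [hg, reluSwitch_zero]

/-- Summing the jumps within a block recovers the prescribed values. -/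
lemma sum_blockJump_eq (hη : 0 < η) (hc : Monotone c) {y : ℕ → ℝ} (hm : 0 < m) (hr : r < q)
    {G : ℕ} (hj : j < G * m)
    (hx : c (j * q + r) + η ≤ x) (hx' : x ≤ c (j * q + r + 1)) {a : ℕ → ℝ}
    (ha : a = fun i => if i % q = 0 then y i else y i - y (i - 1))
    (hK : ∀ l < q, |a (j * q + l)| ≤ K * (η / 2)) :
    ∑ g ∈ Finset.range G, ∑ l ∈ Finset.range q, blockJump η K c a q m g l x = y (j * q + r) := by
  have h1 : ∀ g ∈ Finset.range G, ∑ l ∈ Finset.range q, blockJump η K c a q m g l x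
      = if g = j / m then ∑ l ∈ Finset.range (r + 1), a (j * q + l) else 0 := by
    intro g _
    rw [Finset.sum_congr rfl fun l hl => blockJump_eq hη hc hm hr hx hx' hK g l
      (Finset.mem_range.1 hl)]
    by_cases hg : g = j / m
    · simp only [hg, true_and, if_true]
      rw [← Finset.sum_filter]
      refine Finset.sum_congr ?_ fun _ _ => rfl
      ext l
      simp only [Finset.mem_filter, Finset.mem_range]
      omega
    · simp [hg]
  rw [Finset.sum_congr rfl h1, Finset.sum_ite_eq', if_pos]
  · clear h1 hx hx' hK
    induction r with
    | zero => simp [ha]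
    | succ r ih =>
      rw [Finset.sum_range_succ, ih (by omega), ha]
      have : (j * q + (r + 1)) % q ≠ 0 := by
        rw [add_comm, Nat.add_mul_mod_self_right, Nat.mod_eq_of_lt hr]
        omega
      simp only [this, if_false]
      rw [show j * q + (r + 1) - 1 = j * q + r by omega]
      ring
  · exact Finset.mem_range.2 ((Nat.div_lt_iff_lt_mul hm).2 hj)

end Evaluation

/-- Two hidden layers suffice to add the near-jumps of one group to `d` running sums. -/
lemma ReLULayer.exists_add_blockJump {W l d q m : ℕ} {V : Submodule ℝ (ℝ → ℝ)}
    (h : ReLULayer W l V) (hid : id ∈ V) {S : Fin d → ℝ → ℝ} (hS : ∀ k, S k ∈ V)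
    (hW : 2 * m + 2 * d + 4 ≤ W) (hW' : q * (d + 1) + 2 * d + 2 ≤ W)
    (η K : ℝ) (c : ℕ → ℝ) (a : Fin d → ℕ → ℝ) (g : ℕ) :
    ∃ V', ReLULayer W (l + 2) V' ∧ id ∈ V' ∧
      ∀ k, (fun x => S k x + ∑ r ∈ Finset.range q, blockJump η K c (a k) q m g r x) ∈ V' := by
  let sgn : Bool → ℝ := fun s => if s then 1 else -1
  have hconst : ∀ t : ℝ, ∀ {l V}, ReLULayer W l V → (fun _ => t) ∈ V := by
    intro t l V hV
    simpa [Pi.smul_def] using V.smul_mem t hV.one_mem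
  obtain ⟨V₁, hV₁, hmem₁⟩ := h.exists_succ (ι := (Bool ⊕ Fin d × Bool) ⊕ Fin (m + 1) × Bool)
    (by simp; omega)
    (Sum.elim (Sum.elim (fun s x => sgn s * x) (fun ks x => sgn ks.2 * S ks.1 x))
      (fun js x => x - c ((g * m + js.1) * q) - if js.2 then η else 0)) (by
    rintro ((s | ⟨k, s⟩) | ⟨j, s⟩)
    · exact V.smul_mem (sgn s) hid
    · exact V.smul_mem (sgn s) (hS k)
    · exact V.sub_mem (V.sub_mem hid (hconst _ h)) (hconst _ h))
  have hid₁ : id ∈ V₁ := Submodule.mem_of_relu_mem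
    (by simpa [sgn] using hmem₁ (.inl (.inl true))) (by simpa [sgn] using hmem₁ (.inl (.inl false)))
  have hS₁ : ∀ k, S k ∈ V₁ := fun k => Submodule.mem_of_relu_mem
    (by simpa [sgn] using hmem₁ (.inl (.inr (k, true))))
    (by simpa [sgn] using hmem₁ (.inl (.inr (k, false))))
  have hstep : ∀ j ≤ m, softStep η (c ((g * m + j) * q)) ∈ V₁ := by
    intro j hj
    have h1 := hmem₁ (.inr (⟨j, by omega⟩, true))
    have h2 := hmem₁ (.inr (⟨j, by omega⟩, false))
    exact V₁.smul_mem η⁻¹ (V₁.sub_mem (by simpa using h2) (by simpa using h1))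
  have hblock : ∀ f : ℕ → ℝ, blockSum η c q m g f ∈ V₁ := by
    intro f
    have : blockSum η c q m g f = ∑ j ∈ Finset.range m,
        f (g * m + j) • (softStep η (c ((g * m + j) * q)) -
          softStep η (c ((g * m + (j + 1)) * q))) := by
      funext x
      simp [blockSum, softBlock, add_assoc]
    rw [this]
    refine V₁.sum_mem fun j hj => V₁.smul_mem _ (V₁.sub_mem (hstep j ?_) (hstep (j + 1) ?_)) <;>
    have := Finset.mem_range.1 hj <;> omega
  have hphase : ∀ r, blockPhase η K c q m g r ∈ V₁ := fun r =>
    V₁.smul_mem K (V₁.sub_mem hid₁ (hblock _))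
  obtain ⟨V₂, hV₂, hmem₂⟩ := hV₁.exists_succ
    (ι := (Bool ⊕ Fin d × Bool) ⊕ Fin q × Option (Fin d))
    (by simp; omega)
    (Sum.elim (Sum.elim (fun s x => sgn s * x) (fun ks x => sgn ks.2 * S ks.1 x))
      (fun rk x => blockPhase η K c q m g rk.1 x -
        rk.2.elim 0 fun k => blockSum η c q m g (fun j => a k (j * q + rk.1)) x)) (by
    rintro ((s | ⟨k, s⟩) | ⟨r, _ | k⟩)
    · exact V₁.smul_mem (sgn s) hid₁
    · exact V₁.smul_mem (sgn s) (hS₁ k)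
    · simpa using hphase r
    · exact V₁.sub_mem (hphase r) (hblock fun j => a k (j * q + r)))
  refine ⟨V₂, hV₂, Submodule.mem_of_relu_mem
    (by simpa [sgn] using hmem₂ (.inl (.inl true)))
    (by simpa [sgn] using hmem₂ (.inl (.inl false))), fun k => ?_⟩
  have hjump : ∀ r ∈ Finset.range q, blockJump η K c (a k) q m g r ∈ V₂ := by
    intro r hr
    have hr := Finset.mem_range.1 hr
    exact V₂.sub_mem (by simpa using hmem₂ (.inr (⟨r, hr⟩, none)))
      (by simpa using hmem₂ (.inr (⟨r, hr⟩, some k)))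
  have hSk : S k ∈ V₂ := Submodule.mem_of_relu_mem
    (by simpa [sgn] using hmem₂ (.inl (.inr (k, true))))
    (by simpa [sgn] using hmem₂ (.inl (.inr (k, false))))
  convert V₂.add_mem hSk (V₂.sum_mem hjump) using 1
  funext x
  simp

lemma exists_reluLayer_sum_blockJump {W d q m : ℕ}
    (hW : 2 * m + 2 * d + 4 ≤ W) (hW' : q * (d + 1) + 2 * d + 2 ≤ W)
    (η K : ℝ) (c : ℕ → ℝ) (a : Fin d → ℕ → ℝ) (G : ℕ) :
    ∃ V, ReLULayer W (2 * G) V ∧ id ∈ V ∧ ∀ k, (fun x => ∑ g ∈ Finset.range G,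
      ∑ r ∈ Finset.range q, blockJump η K c (a k) q m g r x) ∈ V := by
  induction G with
  | zero =>
    refine ⟨_, .input, Submodule.subset_span (by simp), fun k => ?_⟩
    simp only [Finset.range_zero, Finset.sum_empty]
    exact Submodule.zero_mem _
  | succ G ih =>
    obtain ⟨V, hV, hid, hS⟩ := ih
    simp only [Finset.sum_range_succ]
    exact hV.exists_add_blockJump hid hS hW hW' η K c a G

/-- ReLU networks realize step functions with `G * m * q` steps, up to short transition intervals,
with a bound that depends neither on the thresholds nor on the transition length. -/
theorem exists_mem_NNset1_step {W L d q m G : ℕ} (hm : 0 < m) (hq : 0 < q) (hG : 0 < G)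
    (hW : 2 * m + 2 * d + 4 ≤ W) (hW' : q * (d + 1) + 2 * d + 2 ≤ W) (hL : 2 * G ≤ L)
    (y : ℕ → EuclideanSpace ℝ (Fin d)) :
    ∃ R : ℝ, ∀ c : ℕ → ℝ, Monotone c → ∀ η > 0, ∃ φ ∈ NNset1 d W L, Continuous φ ∧
      (∀ x, ‖φ x‖ ≤ R) ∧ ∀ i < G * m * q, ∀ x, c i + η ≤ x → x ≤ c (i + 1) → φ x = y i := by
  let a : Fin d → ℕ → ℝ := fun k i => if i % q = 0 then y i k else y i k - y (i - 1) k
  obtain ⟨A, hA⟩ : ∃ A, ∀ k, ∀ i < G * m * q, |a k i| ≤ A := by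
    refine ⟨∑ k, ∑ i ∈ Finset.range (G * m * q), |a k i|, fun k i hi => ?_⟩
    refine le_trans ?_ (Finset.single_le_sum (f := fun k => ∑ i ∈ Finset.range (G * m * q), |a k i|)
      (fun k _ => Finset.sum_nonneg fun i _ => abs_nonneg _) (Finset.mem_univ k))
    exact Finset.single_le_sum (f := fun i => |a k i|) (fun i _ => abs_nonneg _)
      (Finset.mem_range.2 hi)
  have hidx : ∀ {g r j}, g < G → r < q → j < g * m + m → j * q + r < G * m * q := by
    intro g r j hg hr hj
    have h1 : j + 1 ≤ G * m := by
      calc j + 1 ≤ (g + 1) * m := by rw [add_mul]; omega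
        _ ≤ G * m := Nat.mul_le_mul_right m hg
    calc j * q + r < (j + 1) * q := by rw [add_mul]; omega
      _ ≤ G * m * q := Nat.mul_le_mul_right q h1
  refine ⟨∑ _k : Fin d, G * (q * (m * A)), fun c hc η hη => ?_⟩
  obtain ⟨V, hV, -, hsum⟩ := exists_reluLayer_sum_blockJump hW hW' η (2 * A / η) c a G
  refine ⟨_, hV.mem_NNset1 (by omega) hL hsum, ?_, fun x => ?_, fun i hi x hx hx' => ?_⟩
  · refine (PiLp.continuous_toLp 2 _).comp (continuous_pi fun k => hV.continuous _ (hsum k))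
  · have habs : ∀ k, |∑ g ∈ Finset.range G, ∑ r ∈ Finset.range q,
        blockJump η (2 * A / η) c (a k) q m g r x| ≤ G * (q * (m * A)) := by
      intro k
      refine (Finset.abs_sum_le_sum_abs _ _).trans ?_
      have : ∀ g ∈ Finset.range G, |∑ r ∈ Finset.range q,
          blockJump η (2 * A / η) c (a k) q m g r x| ≤ q * (m * A) := by
        intro g hg
        refine (Finset.abs_sum_le_sum_abs _ _).trans ?_
        have : ∀ r ∈ Finset.range q, |blockJump η (2 * A / η) c (a k) q m g r x| ≤ m * A :=
          fun r hr => (abs_reluSwitch_le _ _).trans (abs_blockSum_le hη c q m g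
            (fun j hj => hA k _ (hidx (Finset.mem_range.1 hg) (Finset.mem_range.1 hr) hj)) x)
        simpa using Finset.sum_le_sum this
      simpa using Finset.sum_le_sum this
    exact (EuclideanSpace.norm_le_sum _).trans (Finset.sum_le_sum fun k _ => habs k)
  · have hdiv : i / q * q + i % q = i := Nat.div_add_mod' i q
    have hj : i / q < G * m := (Nat.div_lt_iff_lt_mul hq).2 hi
    ext k
    refine (sum_blockJump_eq (y := fun i => y i k) (j := i / q) (r := i % q) hη hc hm
      (Nat.mod_lt i hq) hj (by rwa [hdiv]) (by rwa [hdiv]) rfl fun l hl => ?_).trans ?_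
    · refine (hA k _ (lt_of_lt_of_le ?_ (Nat.mul_le_mul_right q hj))).trans (le_of_eq ?_)
      · rw [Nat.succ_mul]
        omega
      · field_simp
    · simp only [hdiv]

lemma Real.rpow_neg_sub_rpow_neg_le {β a b : ℝ} (hβ : 0 ≤ β) (ha : 0 < a) (hb : 0 < b) :
    a ^ (-β) - b ^ (-β) ≤ β * ((b - a) / a) * a ^ (-β) := by
  have h1 : 1 - β * (b / a - 1) ≤ (b / a) ^ (-β) := by
    have hlog := Real.log_le_sub_one_of_pos (div_pos hb ha)
    rw [Real.rpow_def_of_pos (div_pos hb ha)]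
    have := Real.add_one_le_exp (Real.log (b / a) * -β)
    nlinarith
  have h2 : b ^ (-β) = (b / a) ^ (-β) * a ^ (-β) := by
    rw [← Real.mul_rpow (div_pos hb ha).le ha.le, div_mul_cancel₀ _ ha.ne']
  have h3 : (b - a) / a = b / a - 1 := by field_simp
  rw [h2, h3]
  nlinarith [Real.rpow_pos_of_pos ha (-β)]

/-- The cell of `r ≥ 0` in the partition of the half line obtained by companding with the function
`r ↦ 1 - (1 + r) ^ (-α)`. -/
noncomputable def radialCode (α : ℝ) (m : ℕ) (r : ℝ) : ℕ := ⌊m * (1 - (1 + r) ^ (-α))⌋₊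

/-- The left end point of the `j`-th cell of the companding partition. -/
noncomputable def radialPoint (α : ℝ) (m j : ℕ) : ℝ := (1 - j / m) ^ (-α⁻¹) - 1

lemma radialCode_lt {α : ℝ} {m : ℕ} (hm : 0 < m) {r : ℝ} (hr : 0 ≤ r) : radialCode α m r < m := by
  have : 0 < (1 + r) ^ (-α) := Real.rpow_pos_of_pos (by linarith) _
  have hm' : (0 : ℝ) < m := by exact_mod_cast hm
  exact (Nat.floor_lt' hm.ne').2 (by nlinarith)

lemma abs_sub_radialPoint_le {α : ℝ} (hα : 0 < α) {m : ℕ} (hm : 0 < m) {r : ℝ} (hr : 0 ≤ r) :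
    |r - radialPoint α m (radialCode α m r)| ≤ α⁻¹ / m * (1 + r) ^ (1 + α) := by
  have hr1 : 0 < 1 + r := by linarith
  have hm' : (0 : ℝ) < m := by exact_mod_cast hm
  set a := (1 + r) ^ (-α) with ha
  have ha0 : 0 < a := Real.rpow_pos_of_pos hr1 _
  have ha1 : a ≤ 1 := Real.rpow_le_one_of_one_le_of_nonpos (by linarith) (by linarith)
  set j := radialCode α m r with hj
  have hj1 : (j : ℝ) ≤ m * (1 - a) := Nat.floor_le (by nlinarith)
  have hj2 : m * (1 - a) < j + 1 := Nat.lt_floor_add_one _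
  have hab : a ≤ 1 - j / m := by
    have : (j : ℝ) / m ≤ 1 - a := (div_le_iff₀ hm').2 (by linarith)
    linarith
  have hab' : 1 - j / m - a ≤ (m : ℝ)⁻¹ := by
    have : 1 - a ≤ (j + 1) / m := (le_div_iff₀ hm').2 (by linarith)
    rw [add_div, one_div] at this
    linarith
  have har : a ^ (-α⁻¹) = 1 + r := by
    rw [ha, ← Real.rpow_mul hr1.le, neg_mul_neg, mul_inv_cancel₀ hα.ne', Real.rpow_one]
  have hmono : (1 - (j : ℝ) / m) ^ (-α⁻¹) ≤ 1 + r :=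
    har ▸ Real.rpow_le_rpow_of_nonpos ha0 hab (by simpa using hα.le)
  have hbound := Real.rpow_neg_sub_rpow_neg_le (inv_nonneg.2 hα.le) ha0 (ha0.trans_le hab)
  rw [har] at hbound
  have hainv : a⁻¹ = (1 + r) ^ α := by rw [ha, Real.rpow_neg hr1.le, inv_inv]
  rw [radialPoint, abs_of_nonneg (by linarith), Real.rpow_add hr1, Real.rpow_one]
  calc r - ((1 - (j : ℝ) / m) ^ (-α⁻¹) - 1) ≤ α⁻¹ * ((1 - j / m - a) / a) * (1 + r) := by
        linarith
    _ ≤ α⁻¹ * ((m : ℝ)⁻¹ / a) * (1 + r) := by gcongr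
    _ = α⁻¹ / m * ((1 + r) * (1 + r) ^ α) := by rw [div_eq_mul_inv _ a, hainv]; ring

/-- A quantizer with `n` points whose error is of order `n ^ (-1 / d)` at every point, with a
constant that grows polynomially in the point. -/
theorem exists_quantizer {d : ℕ} (hd : 0 < d) {α : ℝ} (hα : 0 < α) :
    ∃ C : ℝ, 0 < C ∧ ∀ n : ℕ, 0 < n → ∃ k : EuclideanSpace ℝ (Fin d) → ℕ, Measurable k ∧
      (∀ x, k x < n) ∧ ∃ y : ℕ → EuclideanSpace ℝ (Fin d),
        ∀ x, ‖x - y (k x)‖ ≤ C * (n : ℝ) ^ (-1 / (d : ℝ)) * (1 + ‖x‖) ^ (1 + α) := by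
  have hd' : (0 : ℝ) < d := by exact_mod_cast hd
  refine ⟨2 + 4 * d / α, by positivity, fun n hn => ?_⟩
  have hn' : (0 : ℝ) < n := by exact_mod_cast hn
  set X : ℝ := (n : ℝ) ^ (1 / (d : ℝ)) with hX
  have hX0 : 0 < X := Real.rpow_pos_of_pos hn' _
  have hXn : X ^ d = n := by rw [hX, one_div, Real.rpow_inv_natCast_pow hn'.le hd.ne']
  have hXinv : (n : ℝ) ^ (-1 / (d : ℝ)) = X⁻¹ := by rw [hX, ← Real.rpow_neg hn'.le, neg_div]
  rw [hXinv]
  rcases lt_or_ge X 2 with hX2 | hX2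
  · refine ⟨fun _ => 0, measurable_const, fun _ => hn, fun _ => 0, fun x => ?_⟩
    have h1 : 1 ≤ (2 + 4 * d / α) * X⁻¹ := by
      rw [← div_eq_mul_inv, one_le_div hX0]
      have : 0 < 4 * d / α := by positivity
      linarith
    have h2 : 1 + ‖x‖ ≤ (1 + ‖x‖) ^ (1 + α) :=
      Real.self_le_rpow_of_one_le (by linarith [norm_nonneg x]) (by linarith)
    have h3 : 0 ≤ (1 + ‖x‖) ^ (1 + α) := by positivity
    rw [sub_zero]
    nlinarith
  · set m := ⌊X / 2⌋₊ with hm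
    have hm0 : 0 < m := Nat.floor_pos.2 (by linarith)
    have hm1 : (m : ℝ) ≤ X / 2 := Nat.floor_le (by positivity)
    have hm2 : X / 4 ≤ m := by
      have h1 := Nat.lt_floor_add_one (X / 2)
      have h2 : (1 : ℝ) ≤ m := by exact_mod_cast hm0
      linarith
    let code : EuclideanSpace ℝ (Fin d) → Fin d → Bool × ℕ :=
      fun x i => (decide (0 ≤ x i), radialCode α m |x i|)
    let point : (Fin d → Bool × ℕ) → EuclideanSpace ℝ (Fin d) := fun s =>
      WithLp.toLp 2 fun i => if (s i).1 then radialPoint α m (s i).2 else -radialPoint α m (s i).2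
    let S : Finset (Fin d → Bool × ℕ) :=
      Fintype.piFinset fun _ => Finset.univ ×ˢ Finset.range m
    have hS : S.card ≤ n := by
      have : ((2 * m) ^ d : ℝ) ≤ n := by
        rw [← hXn]
        exact pow_le_pow_left₀ (by positivity) (by linarith) d
      simp only [S, Fintype.card_piFinset, Finset.card_product, Finset.card_univ,
        Fintype.card_bool, Finset.card_range, Finset.prod_const, Fintype.card_fin]
      exact_mod_cast this
    have hcodeS : ∀ x, code x ∈ S := fun x => by
      simp only [S, code, Fintype.mem_piFinset, Finset.mem_product, Finset.mem_univ, true_and,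
        Finset.mem_range]
      exact fun i => radialCode_lt hm0 (abs_nonneg _)
    have hcode : Measurable code := by
      refine measurable_pi_lambda _ fun i => Measurable.prodMk ?_ ?_
      · refine measurable_to_bool ?_
        simpa [Set.preimage] using
          measurableSet_le (f := fun _ : EuclideanSpace ℝ (Fin d) => (0 : ℝ)) measurable_const
            (by fun_prop : Measurable fun x : EuclideanSpace ℝ (Fin d) => x i)
      · exact Nat.measurable_floor.comp (by fun_prop)
    let e : (Fin d → Bool × ℕ) → ℕ := fun s => if h : s ∈ S then S.equivFin ⟨s, h⟩ else 0
    refine ⟨fun x => e (code x), (Measurable.of_discrete (f := e)).comp hcode, fun x => ?_,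
      fun i => if h : i < S.card then point (S.equivFin.symm ⟨i, h⟩) else 0, fun x => ?_⟩
    · simp only [e, hcodeS, dif_pos]
      exact (Fin.is_lt _).trans_le hS
    · simp only [e, hcodeS, dif_pos, Fin.is_lt, Fin.eta, Equiv.symm_apply_apply]
      have hcoord : ∀ i, |(x - point (code x)) i| ≤ α⁻¹ / m * (1 + ‖x‖) ^ (1 + α) := by
        intro i
        have h1 : |(x - point (code x)) i|
            = |(|x i| - radialPoint α m (radialCode α m |x i|))| := by
          by_cases hi : 0 ≤ x i
          · simp [point, code, hi, abs_of_nonneg]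
          · rw [← abs_neg]
            simp [point, code, hi, abs_of_neg (not_le.1 hi)]
            congr 1
            ring
        rw [h1]
        refine (abs_sub_radialPoint_le hα hm0 (abs_nonneg _)).trans ?_
        have : |x i| ≤ ‖x‖ := PiLp.norm_apply_le x i
        gcongr
      calc ‖x - point (code x)‖ ≤ ∑ _i : Fin d, α⁻¹ / m * (1 + ‖x‖) ^ (1 + α) :=
            (EuclideanSpace.norm_le_sum _).trans (Finset.sum_le_sum fun i _ => hcoord i)
        _ = d / α * (m : ℝ)⁻¹ * (1 + ‖x‖) ^ (1 + α) := by
            simp only [Finset.sum_const, Finset.card_univ, Fintype.card_fin, nsmul_eq_mul]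
            ring
        _ ≤ d / α * (X / 4)⁻¹ * (1 + ‖x‖) ^ (1 + α) := by gcongr
        _ = 4 * d / α * X⁻¹ * (1 + ‖x‖) ^ (1 + α) := by
            rw [inv_div]
            ring
        _ ≤ (2 + 4 * d / α) * X⁻¹ * (1 + ‖x‖) ^ (1 + α) := by
            gcongr
            linarith

section Coupling

variable {E F : Type*} [MeasurableSpace E] [MeasurableSpace F]

lemma sum_restrict_eq_of_ae_mem {ν : Measure F} {J : ℕ → Set F} {n : ℕ}
    (hJm : ∀ i, MeasurableSet (J i)) (hJd : Pairwise (Function.onFun Disjoint J))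
    (hJ : ∀ᵐ t ∂ν, ∃ i < n, t ∈ J i) : ∑ i ∈ Finset.range n, ν.restrict (J i) = ν := by
  have h := Measure.restrict_biUnion_finset (μ := ν) (T := Finset.range n) (s := J)
    (fun i _ j _ hij => hJd hij) hJm
  rw [← Measure.sum_coe_finset, ← h]
  refine Measure.restrict_eq_self_of_ae_mem ?_
  simpa using hJ

/-- The normalized product of two finite measures of the same mass is a coupling. -/
lemma exists_coupling (ρ : Measure E) (τ : Measure F) [IsFiniteMeasure ρ] [IsFiniteMeasure τ]
    (h : ρ univ = τ univ) :
    ∃ π : Measure (E × F), π.map Prod.fst = ρ ∧ π.map Prod.snd = τ := by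
  by_cases h0 : ρ univ = 0
  · refine ⟨0, ?_, ?_⟩
    · simpa using (Measure.measure_univ_eq_zero.1 h0).symm
    · simpa using (Measure.measure_univ_eq_zero.1 (h ▸ h0)).symm
  · have hmul : (ρ univ)⁻¹ * ρ univ = 1 := ENNReal.inv_mul_cancel h0 (measure_ne_top ρ univ)
    refine ⟨(ρ univ)⁻¹ • ρ.prod τ, ?_, ?_⟩
    · rw [Measure.map_smul, Measure.map_fst_prod, smul_smul, ← h, hmul, one_smul]
    · rw [Measure.map_smul, Measure.map_snd_prod, smul_smul, hmul, one_smul]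

lemma lintegral_edist_rpow_le_of_marginals {E : Type*} [MeasurableSpace E] [PseudoEMetricSpace E]
    [OpensMeasurableSpace E] [SecondCountableTopology E]
    {p : ℝ} (hp : 1 ≤ p) {ρ : Measure E} {τ : Measure F} {π : Measure (E × F)}
    (hρ : π.map Prod.fst = ρ) (hτ : π.map Prod.snd = τ) {φ : F → E} (hφ : Measurable φ) (y : E) :
    ∫⁻ z, edist z.1 (φ z.2) ^ p ∂π
      ≤ 2 ^ (p - 1) * (∫⁻ x, edist x y ^ p ∂ρ + ∫⁻ t, edist y (φ t) ^ p ∂τ) := by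
  have hf : Measurable fun x : E => edist x y ^ p := by fun_prop
  have hg : Measurable fun t : F => edist y (φ t) ^ p := by fun_prop
  calc ∫⁻ z, edist z.1 (φ z.2) ^ p ∂π
      ≤ ∫⁻ z, 2 ^ (p - 1) * (edist z.1 y ^ p + edist y (φ z.2) ^ p) ∂π := by
        refine lintegral_mono fun z => ?_
        refine le_trans ?_ (ENNReal.rpow_add_le_mul_rpow_add_rpow _ _ hp)
        gcongr
        exact edist_triangle _ _ _
    _ = 2 ^ (p - 1) * (∫⁻ x, edist x y ^ p ∂ρ + ∫⁻ t, edist y (φ t) ^ p ∂τ) := by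
        rw [lintegral_const_mul _ (by fun_prop), lintegral_add_left (by fun_prop), ← hρ, ← hτ,
          lintegral_map hf measurable_fst, lintegral_map hg measurable_snd]

/-- If the cells `{k = i}` and `J i` have the same masses, the transport cost between `μ` and
`φ_# ν` is controlled by the distances to the points `y i` on the cells. -/
theorem WppENN_map_le {E : Type*} [MeasurableSpace E] [PseudoEMetricSpace E]
    [OpensMeasurableSpace E] [SecondCountableTopology E]
    {p : ℝ} (hp : 1 ≤ p) {μ : Measure E} [IsFiniteMeasure μ] {ν : Measure F} [IsFiniteMeasure ν]
    {k : E → ℕ} (hk : Measurable k) {n : ℕ} (hkn : ∀ x, k x < n) {J : ℕ → Set F}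
    (hJ : ∑ i ∈ Finset.range n, ν.restrict (J i) = ν)
    (hμν : ∀ i < n, μ (k ⁻¹' {i}) = ν (J i)) {φ : F → E} (hφ : Measurable φ) (y : ℕ → E) :
    WppENN p μ (ν.map φ) ≤ 2 ^ (p - 1) *
      (∫⁻ x, edist x (y (k x)) ^ p ∂μ
        + ∑ i ∈ Finset.range n, ∫⁻ t in J i, edist (y i) (φ t) ^ p ∂ν) := by
  have hA : ∀ i, MeasurableSet (k ⁻¹' {i}) := fun i => hk (measurableSet_singleton i)
  have hμ : ∑ i ∈ Finset.range n, μ.restrict (k ⁻¹' {i}) = μ :=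
     sum_restrict_eq_of_ae_mem hA
      (fun i j hij => (Set.disjoint_singleton.2 hij).preimage k)
      (ae_of_all _ fun x => ⟨_, hkn x, rfl⟩)
  have hπ : ∀ i, ∃ π : Measure (E × F), i < n →
      π.map Prod.fst = μ.restrict (k ⁻¹' {i}) ∧ π.map Prod.snd = ν.restrict (J i) := by
    intro i
    by_cases hi : i < n
    · obtain ⟨π, h⟩ := exists_coupling (μ.restrict (k ⁻¹' {i})) (ν.restrict (J i))
        (by simpa using hμν i hi)
      exact ⟨π, fun _ => h⟩
    · exact ⟨0, fun h => absurd h hi⟩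
  choose π hπ using hπ
  have hΦ : Measurable fun z : E × F => (z.1, φ z.2) := by fun_prop
  have hfst : (∑ i ∈ Finset.range n, π i).map Prod.fst = μ := by
    rw [Measure.map_finset_sum measurable_fst.aemeasurable]
    refine Eq.trans ?_ hμ
    exact Finset.sum_congr rfl fun i hi => (hπ i (Finset.mem_range.1 hi)).1
  have hsnd : (∑ i ∈ Finset.range n, π i).map Prod.snd = ν := by
    rw [Measure.map_finset_sum measurable_snd.aemeasurable]
    refine Eq.trans ?_ hJ
    exact Finset.sum_congr rfl fun i hi => (hπ i (Finset.mem_range.1 hi)).2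
  refine (iInf₂_le ((∑ i ∈ Finset.range n, π i).map fun z => (z.1, φ z.2)) ⟨?_, ?_⟩).trans ?_
  rotate_left
  · rw [Measure.map_map measurable_fst hΦ]
    exact hfst
  · rw [Measure.map_map measurable_snd hΦ]
    conv_rhs => rw [← hsnd, Measure.map_map hφ measurable_snd]
    rfl
  · have hμsum : ∫⁻ x, edist x (y (k x)) ^ p ∂μ
        = ∑ i ∈ Finset.range n, ∫⁻ x in k ⁻¹' {i}, edist x (y i) ^ p ∂μ := by
      nth_rw 1 [← hμ]
      rw [lintegral_finsetSum_measure]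
      refine Finset.sum_congr rfl fun i _ => setLIntegral_congr_fun (hA i) fun x hx => ?_
      rw [show k x = i from hx]
    rw [lintegral_map (by fun_prop) hΦ, lintegral_finsetSum_measure, hμsum,
      ← Finset.sum_add_distrib, Finset.mul_sum]
    refine Finset.sum_le_sum fun i hi => ?_
    obtain ⟨h1, h2⟩ := hπ i (Finset.mem_range.1 hi)
    exact lintegral_edist_rpow_le_of_marginals hp h1 h2 hφ (y i)

end Coupling

section Cdf

open ProbabilityTheory

variable {ν : Measure ℝ}

lemma exists_cdf_eq (hc : Continuous (cdf ν)) {w : ℝ} (hw : w ∈ Ioo (0 : ℝ) 1) :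
    ∃ t, cdf ν t = w := by
  obtain ⟨a, ha⟩ := ((tendsto_cdf_atBot ν).eventually (gt_mem_nhds hw.1)).exists
  obtain ⟨b, hb⟩ := ((tendsto_cdf_atTop ν).eventually (lt_mem_nhds hw.2)).exists
  exact mem_range_of_exists_le_of_exists_ge hc ⟨a, ha.le⟩ ⟨b, hb.le⟩

variable [IsProbabilityMeasure ν]

lemma continuous_cdf_of_measure_singleton (h : ∀ x, ν {x} = 0) : Continuous (cdf ν) := by
  refine continuous_iff_continuousAt.2 fun x => ?_
  rw [(monotone_cdf ν).continuousAt_iff_leftLim_eq_rightLim, (cdf ν).rightLim_eq]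
  have h1 := h x
  rw [← measure_cdf ν, StieltjesFunction.measure_singleton, ENNReal.ofReal_eq_zero] at h1
  linarith [(monotone_cdf ν).leftLim_le (le_refl x)]

lemma measure_cdf_le (hc : Continuous (cdf ν)) {w : ℝ} (hw : w ∈ Icc (0 : ℝ) 1) :
    ν {t | cdf ν t ≤ w} = ENNReal.ofReal w := by
  rcases hw.2.eq_or_lt with rfl | hw1
  · simp [cdf_le_one]
  rcases eq_empty_or_nonempty {t | cdf ν t ≤ w} with hS | hS
  · rw [hS, measure_empty, eq_comm, ENNReal.ofReal_eq_zero]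
    by_contra! hw0
    obtain ⟨t, ht⟩ := exists_cdf_eq hc ⟨hw0, hw1⟩
    exact hS.le ht.le
  · obtain ⟨b, hb⟩ := ((tendsto_cdf_atTop ν).eventually (lt_mem_nhds hw1)).exists
    have hbdd : BddAbove {t | cdf ν t ≤ w} :=
      ⟨b, fun t ht => le_of_not_gt fun hbt => (hb.trans_le (monotone_cdf ν hbt.le)).not_ge ht⟩
    have hmem := (isClosed_le hc continuous_const).csSup_mem hS hbdd
    set s := sSup {t | cdf ν t ≤ w} with hs
    have hIic : {t | cdf ν t ≤ w} = Iic s :=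
      Subset.antisymm (fun t ht => le_csSup hbdd ht)
        fun t ht => (monotone_cdf ν ht).trans hmem
    have hsw : cdf ν s = w := by
      refine le_antisymm hmem ?_
      rcases hw.1.eq_or_lt with rfl | hw0
      · exact cdf_nonneg ν s
      · obtain ⟨t, ht⟩ := exists_cdf_eq hc ⟨hw0, hw1⟩
        exact ht ▸ monotone_cdf ν (le_csSup hbdd ht.le)
    rw [hIic, ← hsw, cdf_eq_real, ofReal_measureReal]

lemma measure_cdf_preimage_Ioc (hc : Continuous (cdf ν)) {v w : ℝ} (hv : 0 ≤ v) (hvw : v ≤ w)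
    (hw : w ≤ 1) : ν (cdf ν ⁻¹' Ioc v w) = ENNReal.ofReal (w - v) := by
  have h : cdf ν ⁻¹' Ioc v w = {t | cdf ν t ≤ w} \ {t | cdf ν t ≤ v} := by
    ext t
    simp [and_comm]
  rw [h, measure_sdiff (s₁ := {t | cdf ν t ≤ w}) (s₂ := {t | cdf ν t ≤ v})
    (fun t ht => le_trans ht hvw)
    (measurableSet_le hc.measurable measurable_const).nullMeasurableSet (measure_ne_top _ _),
    measure_cdf_le hc ⟨hv.trans hvw, hw⟩, measure_cdf_le hc ⟨hv, hvw.trans hw⟩,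
    ENNReal.ofReal_sub _ hv]

lemma ae_cdf_ne (hc : Continuous (cdf ν)) (w : ℝ) : ∀ᵐ t ∂ν, cdf ν t ≠ w := by
  rw [ae_iff]
  simp only [not_not]
  by_cases hw : w ∈ Icc (0 : ℝ) 1
  · refine le_antisymm (ENNReal.le_of_forall_pos_le_add fun ε hε _ => ?_) zero_le
    rcases hw.1.eq_or_lt with rfl | hw0
    · refine (measure_mono (t := {t | cdf ν t ≤ 0}) fun t ht => le_of_eq ht).trans ?_
      rw [measure_cdf_le hc hw]
      simp
    · have hε' : (0 : ℝ) < ε := hε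
      refine (measure_mono (t := cdf ν ⁻¹' Ioc (max 0 (w - ε)) w) fun t ht => ?_).trans ?_
      · rw [mem_preimage, show cdf ν t = w from ht]
        exact ⟨max_lt hw0 (by linarith), le_rfl⟩
      · rw [measure_cdf_preimage_Ioc hc (le_max_left _ _) (max_le hw0.le (by linarith)) hw.2,
          zero_add]
        refine (ENNReal.ofReal_le_ofReal (q := ε) ?_).trans_eq ENNReal.ofReal_coe_nnreal
        linarith [le_max_right 0 (w - ε)]
  · have : {t | cdf ν t = w} = ∅ := eq_empty_of_forall_notMem fun t ht =>
      hw (ht ▸ ⟨cdf_nonneg ν t, cdf_le_one ν t⟩)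
    rw [this, measure_empty]

/-- If `𝒩` contains uniformly bounded versions of the step functions with values `y i`, for all
thresholds and with arbitrarily short transitions, then it approximates the step function of the
quantile coordinate `cdf ν` with the values `y i` and the thresholds `w i`. -/
theorem exists_sum_setLIntegral_le {E : Type*} [NormedAddCommGroup E] [MeasurableSpace E]
    [BorelSpace E] [SecondCountableTopology E]
    (hc : Continuous (cdf ν)) {n : ℕ} {w : ℕ → ℝ} (hwm : Monotone w)
    {y : ℕ → E} {𝒩 : Set (ℝ → E)} {R : ℝ}
    (hstep : ∀ c : ℕ → ℝ, Monotone c → ∀ η > 0, ∃ φ ∈ 𝒩, Continuous φ ∧ (∀ x, ‖φ x‖ ≤ R) ∧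
      ∀ i < n, ∀ x, c i + η ≤ x → x ≤ c (i + 1) → φ x = y i)
    {p : ℝ} (hp : 0 < p) {B : ℝ≥0∞} (hB : 0 < B) :
    ∃ φ ∈ 𝒩, Continuous φ ∧ ∑ i ∈ Finset.range n,
      ∫⁻ t in cdf ν ⁻¹' Ioc (w i) (w (i + 1)), edist (y i) (φ t) ^ p ∂ν ≤ B := by
  have hg : ∀ u, ∃ t, u ∈ Ioo (0 : ℝ) 1 → cdf ν t = u := fun u => by
    by_cases hu : u ∈ Ioo (0 : ℝ) 1
    · obtain ⟨t, ht⟩ := exists_cdf_eq hc hu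
      exact ⟨t, fun _ => ht⟩
    · exact ⟨0, fun h => absurd h hu⟩
  choose g hg using hg
  have hlt : ∀ {s t}, cdf ν s < cdf ν t → s < t := fun h => (monotone_cdf ν).reflect_lt h
  have hgmono : ∀ u ∈ Ioo (0 : ℝ) 1, ∀ v ∈ Ioo (0 : ℝ) 1, u ≤ v → g u ≤ g v := by
    intro u hu v hv huv
    rcases huv.eq_or_lt with rfl | h
    · exact le_rfl
    · exact (hlt (by rwa [hg u hu, hg v hv])).le
  let ε : ℕ → ℝ := fun N => 1 / ((N + 2 : ℕ) + 1)
  have hε0 : ∀ N, 0 < ε N := fun N => Nat.one_div_pos_of_nat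
  have hε1 : ∀ N, ε N ≤ 1 - ε N := fun N => by
    have : ε N ≤ 1 / 2 :=
      one_div_le_one_div_of_le two_pos (by push_cast; linarith [N.cast_nonneg (α := ℝ)])
    linarith
  have hεt : Tendsto ε atTop (𝓝 0) :=
    (tendsto_add_atTop_iff_nat 2).2 (tendsto_one_div_add_atTop_nhds_zero_nat (𝕜 := ℝ))
  let cl : ℕ → ℝ → ℝ := fun N u => max (ε N) (min u (1 - ε N))
  have hcl : ∀ N u, cl N u ∈ Ioo (0 : ℝ) 1 := fun N u =>
    ⟨(hε0 N).trans_le (le_max_left _ _),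
      (max_le (hε1 N) (min_le_right _ _)).trans_lt (by linarith [hε0 N])⟩
  have hclm : ∀ N, Monotone (cl N) := fun N u v huv =>
    max_le_max le_rfl (min_le_min huv le_rfl)
  have hφ := fun N => hstep (fun i => g (cl N (w i)))
    (fun i j hij => hgmono _ (hcl N _) _ (hcl N _) (hclm N (hwm hij))) (ε N) (hε0 N)
  choose φ hφ𝒩 hφc hφR hφy using hφ
  have hev : ∀ i < n, ∀ᵐ t ∂ν.restrict (cdf ν ⁻¹' Ioc (w i) (w (i + 1))),
      ∀ᶠ N in atTop, φ N t = y i := by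
    intro i hi
    have hmeas : MeasurableSet (cdf ν ⁻¹' Ioc (w i) (w (i + 1))) :=
      hc.measurable measurableSet_Ioc
    filter_upwards [ae_restrict_mem hmeas, ae_restrict_of_ae (ae_cdf_ne hc 0),
      ae_restrict_of_ae (ae_cdf_ne hc 1), ae_restrict_of_ae (ae_cdf_ne hc (w (i + 1)))]
      with t ht ht0 ht1 htw
    have ht0' : 0 < cdf ν t := (cdf_nonneg ν t).lt_of_ne' ht0
    have ht1' : cdf ν t < 1 := (cdf_le_one ν t).lt_of_ne ht1
    have htw' : cdf ν t < w (i + 1) := ht.2.lt_of_ne htw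
    obtain ⟨u, hu, hut⟩ := exists_between (max_lt ht.1 ht0')
    have hu01 : u ∈ Ioo (0 : ℝ) 1 := ⟨(le_max_right _ _).trans_lt hu, hut.trans ht1'⟩
    have hgu : g u < t := hlt (by rwa [hg u hu01])
    filter_upwards [hεt.eventually (gt_mem_nhds hu01.1),
      hεt.eventually (gt_mem_nhds (sub_pos.2 hgu)),
      hεt.eventually (gt_mem_nhds (sub_pos.2 ht1'))] with N h1 h2 h3
    refine hφy N i hi t ?_ (hlt ?_).le
    · have : g (cl N (w i)) ≤ g u := hgmono _ (hcl N _) _ hu01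
        (max_le h1.le ((min_le_left _ _).trans ((le_max_left _ _).trans hu.le)))
      linarith
    · rw [hg _ (hcl N _)]
      exact lt_max_of_lt_right (lt_min htw' (by linarith))
  have hlim : Tendsto (fun N => ∑ i ∈ Finset.range n,
      ∫⁻ t in cdf ν ⁻¹' Ioc (w i) (w (i + 1)), edist (y i) (φ N t) ^ p ∂ν) atTop (𝓝 0) := by
    rw [← Finset.sum_const_zero (s := Finset.range n)]
    refine tendsto_finsetSum _ fun i hi => ?_
    rw [← lintegral_zero (μ := ν.restrict (cdf ν ⁻¹' Ioc (w i) (w (i + 1))))]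
    refine tendsto_lintegral_of_dominated_convergence (fun _ => ENNReal.ofReal (‖y i‖ + R) ^ p)
      (fun N => ?_) (fun N => ae_of_all _ fun t => ?_) ?_ ?_
    · have := (hφc N).measurable
      fun_prop
    · refine ENNReal.rpow_le_rpow ?_ hp.le
      rw [edist_dist]
      refine ENNReal.ofReal_le_ofReal ((dist_le_norm_add_norm _ _).trans ?_)
      gcongr
      exact hφR N t
    · rw [lintegral_const]
      exact ENNReal.mul_ne_top (ENNReal.rpow_ne_top_of_nonneg hp.le ENNReal.ofReal_ne_top)
        (measure_ne_top _ _)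
    · filter_upwards [hev i (Finset.mem_range.1 hi)] with t ht
      refine tendsto_const_nhds.congr' ?_
      filter_upwards [ht] with N hN
      rw [hN, edist_self, ENNReal.zero_rpow_of_pos hp]
  obtain ⟨N, hN⟩ := (hlim.eventually (gt_mem_nhds hB)).exists
  exact ⟨φ N, hφ𝒩 N, hφc N, hN.le⟩

end Cdf

lemma lintegral_edist_rpow_le_moment {d : ℕ} {p q : ℝ} (hp : 1 ≤ p) (hpq : p < q)
    {μ : Measure (EuclideanSpace ℝ (Fin d))} [IsProbabilityMeasure μ]
    {T : EuclideanSpace ℝ (Fin d) → EuclideanSpace ℝ (Fin d)} {K : ℝ} (hK : 0 ≤ K)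
    (hT : ∀ x, ‖x - T x‖ ≤ K * (1 + ‖x‖) ^ (q / p)) :
    ∫⁻ x, edist x (T x) ^ p ∂μ ≤ ENNReal.ofReal K ^ p * (2 ^ (q - 1) * (1 + moment q μ)) := by
  have hp0 : 0 < p := by linarith
  have hmeas : Measurable fun x : EuclideanSpace ℝ (Fin d) => ENNReal.ofReal ‖x‖ ^ q := by fun_prop
  have hpt : ∀ x, edist x (T x) ^ p
      ≤ ENNReal.ofReal K ^ p * (2 ^ (q - 1) * (1 + ENNReal.ofReal ‖x‖ ^ q)) := fun x => by
    calc edist x (T x) ^ p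
        ≤ (ENNReal.ofReal K * (1 + ENNReal.ofReal ‖x‖) ^ (q / p)) ^ p := by
          gcongr
          rw [edist_dist, dist_eq_norm]
          refine (ENNReal.ofReal_le_ofReal (hT x)).trans_eq ?_
          rw [ENNReal.ofReal_mul hK, ← ENNReal.ofReal_rpow_of_nonneg (by positivity)
            (div_nonneg (by linarith) hp0.le), ENNReal.ofReal_add zero_le_one (norm_nonneg x),
            ENNReal.ofReal_one]
      _ = ENNReal.ofReal K ^ p * (1 + ENNReal.ofReal ‖x‖) ^ q := by
          rw [ENNReal.mul_rpow_of_nonneg _ _ hp0.le, ← ENNReal.rpow_mul, div_mul_cancel₀ _ hp0.ne']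
      _ ≤ ENNReal.ofReal K ^ p * (2 ^ (q - 1) * (1 + ENNReal.ofReal ‖x‖ ^ q)) := by
          gcongr
          simpa using ENNReal.rpow_add_le_mul_rpow_add_rpow 1 (ENNReal.ofReal ‖x‖)
            (by linarith : 1 ≤ q)
  refine (lintegral_mono hpt).trans_eq ?_
  rw [lintegral_const_mul _ (by fun_prop), lintegral_const_mul _ (by fun_prop),
    lintegral_add_left measurable_const, lintegral_const, measure_univ, mul_one, moment]

/-- Networks of width `W` and depth `L` have room for a number of steps of order `W ^ 2 * L`. -/
lemma exists_step_parameters {d W L : ℕ} (hd : 0 < d) (hW : 7 * d + 1 ≤ W) (hL : 2 ≤ L) :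
    ∃ m q G : ℕ, 0 < m ∧ 0 < q ∧ 0 < G ∧ 2 * m + 2 * d + 4 ≤ W ∧ q * (d + 1) + 2 * d + 2 ≤ W ∧
      2 * G ≤ L ∧ W ^ 2 * L ≤ 512 * (d + 1) * (G * m * q) := by
  have hq4 : 4 * (W / (4 * (d + 1)) * (d + 1)) ≤ W := by
    have := Nat.div_mul_le_self W (4 * (d + 1))
    linarith
  have hq0 : 0 < W / (4 * (d + 1)) := Nat.div_pos (by omega) (by omega)
  have hq8 : W ≤ 8 * (d + 1) * (W / (4 * (d + 1))) := by
    have := Nat.lt_div_mul_add (a := W) (b := 4 * (d + 1)) (by omega)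
    nlinarith
  have hm : W ≤ 16 * (W / 8) := by omega
  have hG : L ≤ 4 * (L / 2) := by omega
  refine ⟨W / 8, W / (4 * (d + 1)), L / 2, by omega, hq0, by omega, by omega, by omega,
    by omega, ?_⟩
  calc W ^ 2 * L = W * W * L := by ring
    _ ≤ (16 * (W / 8)) * (8 * (d + 1) * (W / (4 * (d + 1)))) * (4 * (L / 2)) := by gcongr
    _ = _ := by ring

/-- The rate `(W ^ 2 * L) ^ (-1 / d)` without logarithmic factor, for all `q > p`: quantize `μ` by a
companding partition and realize the quantized measure up to an arbitrarily small error. -/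
theorem exists_mem_NNset1_Wdist_le {p q : ℝ} {d : ℕ} (hd : 0 < d) (hp : 1 ≤ p) (hpq : p < q) :
    ∃ C : ℝ, 0 < C ∧ ∀ ν : Measure ℝ, IsProbabilityMeasure ν → ν ≪ volume →
      ∀ μ : Measure (EuclideanSpace ℝ (Fin d)), IsProbabilityMeasure μ → moment q μ ≠ ⊤ →
        ∀ W L : ℕ, 7 * d + 1 ≤ W → 2 ≤ L → ∃ φ ∈ NNset1 d W L, Wdist p μ (ν.map φ) ≤
          ENNReal.ofReal (C * (Mq q μ ^ q + 1) ^ (1 / p) *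
            ((W ^ 2 * L : ℕ) : ℝ) ^ (-1 / (d : ℝ))) := by
  have hp0 : 0 < p := by linarith
  have hd' : (0 : ℝ) < d := by exact_mod_cast hd
  obtain ⟨C, hC, hquant⟩ := exists_quantizer hd (div_pos (sub_pos.2 hpq) hp0)
  have hα : 1 + (q - p) / p = q / p := by field_simp; ring
  rw [hα] at hquant
  set D : ℝ := 512 * (d + 1) with hD
  have hD0 : 0 < D := by positivity
  refine ⟨2 * (C * D ^ (1 / (d : ℝ))) * 2 ^ ((q - 1) / p), by positivity,
    fun ν hν hνv μ hμ hM W L hW hL => ?_⟩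
  obtain ⟨m, r, G, hm, hr, hG, hmW, hrW, hGL, hWL⟩ := exists_step_parameters hd hW hL
  set n := G * m * r with hn
  have hn0 : 0 < n := by positivity
  obtain ⟨k, hk, hkn, y, hy⟩ := hquant n hn0
  obtain ⟨R, hstep⟩ := exists_mem_NNset1_step hm hr hG hmW hrW hGL y
  have hK0 : 0 < C * (n : ℝ) ^ (-1 / (d : ℝ)) := by positivity
  have hc := continuous_cdf_of_measure_singleton (ν := ν) fun x => hνv Real.volume_singleton
  let w : ℕ → ℝ := fun i => μ.real {x | k x < i}
  have hwm : Monotone w := fun i j hij => measureReal_mono fun x hx => lt_of_lt_of_le hx hij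
  have hw0 : w 0 = 0 := by simp [w]
  have hwn : w n = 1 := by simp [w, hkn]
  have hμw : ∀ i, ENNReal.ofReal (w (i + 1) - w i) = μ (k ⁻¹' {i}) := fun i => by
    have h1 : {x | k x < i + 1} = {x | k x < i} ∪ k ⁻¹' {i} := by
      ext x
      simp [le_iff_lt_or_eq]
    have h2 : Disjoint {x | k x < i} (k ⁻¹' {i}) :=
      Set.disjoint_left.2 fun x hx hx' => (show k x < i from hx).ne hx'
    simp only [w]
    rw [h1, measureReal_union h2 (hk (measurableSet_singleton i)), add_sub_cancel_left,
      ofReal_measureReal]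
  let J : ℕ → Set ℝ := fun i => ProbabilityTheory.cdf ν ⁻¹' Ioc (w i) (w (i + 1))
  have hJ : ∑ i ∈ Finset.range n, ν.restrict (J i) = ν := by
    refine sum_restrict_eq_of_ae_mem (fun i => hc.measurable measurableSet_Ioc)
      (fun i j hij => (hwm.pairwise_disjoint_on_Ioc_succ hij).preimage _) ?_
    filter_upwards [ae_cdf_ne hc 0] with t ht
    have ht0 := (ProbabilityTheory.cdf_nonneg ν t).lt_of_ne' ht
    have hex : ∃ i, ProbabilityTheory.cdf ν t ≤ w i :=
      ⟨n, hwn.symm ▸ ProbabilityTheory.cdf_le_one ν t⟩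
    have hpos : Nat.find hex ≠ 0 := fun h => by
      have := Nat.find_spec hex
      rw [h, hw0] at this
      exact this.not_gt ht0
    obtain ⟨i, hi⟩ := Nat.exists_eq_succ_of_ne_zero hpos
    refine ⟨i, ?_, ?_, ?_⟩
    · have : Nat.find hex ≤ n := Nat.find_min' hex (hwn.symm ▸ ProbabilityTheory.cdf_le_one ν t)
      omega
    · exact not_le.1 (Nat.find_min hex (by omega))
    · simpa only [hi] using Nat.find_spec hex
  have hμν : ∀ i < n, μ (k ⁻¹' {i}) = ν (J i) := fun i _ => by
    rw [← hμw, measure_cdf_preimage_Ioc hc measureReal_nonneg (hwm i.le_succ) measureReal_le_one]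
  set B : ℝ≥0∞ := ENNReal.ofReal (C * (n : ℝ) ^ (-1 / (d : ℝ))) ^ p *
    (2 ^ (q - 1) * (1 + moment q μ)) with hB
  have hB0 : 0 < B := by
    refine ENNReal.mul_pos ?_ (ENNReal.mul_pos ?_ (by simp)).ne'
    · exact (ENNReal.rpow_pos (ENNReal.ofReal_pos.2 hK0) ENNReal.ofReal_ne_top).ne'
    · exact (ENNReal.rpow_pos two_pos ENNReal.ofNat_ne_top).ne'
  obtain ⟨φ, hφ𝒩, hφc, hφB⟩ := exists_sum_setLIntegral_le hc hwm hstep hp0 hB0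
  refine ⟨φ, hφ𝒩, ?_⟩
  have hcost : WppENN p μ (ν.map φ) ≤ 2 ^ p * B := by
    refine (WppENN_map_le hp hk hkn hJ hμν hφc.measurable y).trans ?_
    calc _ ≤ (2 : ℝ≥0∞) ^ (p - 1) * (B + B) := by
          gcongr
          exact lintegral_edist_rpow_le_moment hp hpq hK0.le hy
      _ = 2 ^ p * B := by
          rw [← two_mul, ← mul_assoc]
          nth_rw 2 [← ENNReal.rpow_one 2]
          rw [← ENNReal.rpow_add _ _ two_ne_zero ENNReal.ofNat_ne_top, sub_add_cancel]
  have hMq : 1 + moment q μ = ENNReal.ofReal (Mq q μ ^ q + 1) := by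
    rw [Mq, ← Real.rpow_mul ENNReal.toReal_nonneg, one_div_mul_cancel (by linarith), Real.rpow_one,
      ENNReal.ofReal_add ENNReal.toReal_nonneg zero_le_one, ENNReal.ofReal_toReal hM,
      ENNReal.ofReal_one, add_comm]
  have hMq0 : 0 ≤ Mq q μ ^ q + 1 :=
    add_nonneg (Real.rpow_nonneg (Real.rpow_nonneg ENNReal.toReal_nonneg _) _) zero_le_one
  have hroot : (2 ^ p * B) ^ (1 / p) = ENNReal.ofReal (2 * (C * (n : ℝ) ^ (-1 / (d : ℝ))) *
      2 ^ ((q - 1) / p) * (Mq q μ ^ q + 1) ^ (1 / p)) := by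
    have hp1 : 0 ≤ 1 / p := by positivity
    rw [hB, hMq, ENNReal.mul_rpow_of_nonneg _ _ hp1, ENNReal.mul_rpow_of_nonneg _ _ hp1,
      ENNReal.mul_rpow_of_nonneg _ _ hp1, ← ENNReal.rpow_mul, ← ENNReal.rpow_mul,
      ← ENNReal.rpow_mul, mul_one_div_cancel hp0.ne', mul_one_div, ENNReal.rpow_one,
      ENNReal.rpow_one, ENNReal.ofReal_mul (q := (Mq q μ ^ q + 1) ^ (1 / p)) (by positivity),
      ENNReal.ofReal_mul (q := 2 ^ ((q - 1) / p)) (by positivity), ENNReal.ofReal_mul zero_le_two,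
      ENNReal.ofReal_rpow_of_nonneg hMq0 hp1,
      ← ENNReal.ofReal_rpow_of_pos two_pos, ENNReal.ofReal_ofNat]
    ring
  have hnWL : (n : ℝ) ^ (-1 / (d : ℝ))
      ≤ D ^ (1 / (d : ℝ)) * ((W ^ 2 * L : ℕ) : ℝ) ^ (-1 / (d : ℝ)) := by
    have hWL0 : (0 : ℝ) < (W ^ 2 * L : ℕ) := by
      have : 0 < W := by omega
      have : 0 < L := by omega
      positivity
    have hWL' : ((W ^ 2 * L : ℕ) : ℝ) ≤ D * n := by rw [hD]; exact_mod_cast hWL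
    calc (n : ℝ) ^ (-1 / (d : ℝ)) = D ^ (1 / (d : ℝ)) * (D * n) ^ (-1 / (d : ℝ)) := by
          rw [Real.mul_rpow hD0.le (Nat.cast_nonneg n), ← mul_assoc, ← Real.rpow_add hD0, neg_div,
            add_neg_cancel, Real.rpow_zero, one_mul]
      _ ≤ _ := by
          gcongr D ^ (1 / (d : ℝ)) * ?_
          exact Real.rpow_le_rpow_of_nonpos hWL0 hWL'
            (div_nonpos_of_nonpos_of_nonneg (by norm_num) hd'.le)
  calc Wdist p μ (ν.map φ) ≤ (2 ^ p * B) ^ (1 / p) := by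
        rw [Wdist]
        gcongr
    _ ≤ _ := by
        rw [hroot]
        refine ENNReal.ofReal_le_ofReal ?_
        calc _ ≤ 2 * (C * (D ^ (1 / (d : ℝ)) * ((W ^ 2 * L : ℕ) : ℝ) ^ (-1 / (d : ℝ)))) *
              2 ^ ((q - 1) / p) * (Mq q μ ^ q + 1) ^ (1 / p) := by gcongr
          _ = _ := by ring

/-- Theorem: approximation of distributions with finite moment by deep
generative networks in Wasserstein distance. -/
theorem statement0 (p q : ℝ) (d : ℕ) (hd : 0 < d) (hp : 1 ≤ p) (hpq : p < q) :
    ∃ C : ℝ, 0 < C ∧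
      ∀ ν : Measure ℝ, IsProbabilityMeasure ν → ν ≪ volume →
      ∀ μ : Measure (EuclideanSpace ℝ (Fin d)), IsProbabilityMeasure μ →
        moment q μ ≠ ⊤ →
        ∀ W L : ℕ, 7 * d + 1 ≤ W → 2 ≤ L →
          (p + p / d < q →
            (⨅ φ ∈ NNset1 d W L, Wdist p μ (ν.map φ)) ≤
              ENNReal.ofReal (C * (Mq q μ ^ q + 1) ^ (1 / p) *
                ((W ^ 2 * L : ℕ) : ℝ) ^ (-1 / (d : ℝ)))) ∧
          (q ≤ p + p / d →
            (⨅ φ ∈ NNset1 d W L, Wdist p μ (ν.map φ)) ≤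
              ENNReal.ofReal (C * (Mq q μ ^ q + 1) ^ (1 / p) *
                ((W ^ 2 * L : ℕ) : ℝ) ^ (-1 / (d : ℝ)) *
                Real.logb 2 ((W ^ 2 * L : ℕ) : ℝ) ^ (1 / (d : ℝ)))) := by
  obtain ⟨C, hC, h⟩ := exists_mem_NNset1_Wdist_le hd hp hpq
  refine ⟨C, hC, fun ν hν hνv μ hμ hM W L hW hL => ?_⟩
  obtain ⟨φ, hφ, hle⟩ := h ν hν hνv μ hμ hM W L hW hL
  refine ⟨fun _ => (iInf₂_le φ hφ).trans hle, fun _ => (iInf₂_le φ hφ).trans (hle.trans ?_)⟩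
  have hlog : 1 ≤ Real.logb 2 ((W ^ 2 * L : ℕ) : ℝ) ^ (1 / (d : ℝ)) := by
    have hWL : 2 ≤ W ^ 2 * L := by nlinarith [show 1 ≤ W ^ 2 from Nat.one_le_pow _ _ (by omega)]
    refine Real.one_le_rpow ?_ (by positivity)
    rw [Real.le_logb_iff_rpow_le one_lt_two (by positivity), Real.rpow_one]
    exact_mod_cast hWL
  have hMq : 0 ≤ Mq q μ := Real.rpow_nonneg ENNReal.toReal_nonneg _
  exact ENNReal.ofReal_le_ofReal (le_mul_of_one_le_right (by positivity) hlog)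
end

section
/- For any probability measure $\mu$ on $\mathbb{R}^d$ and any $p \in [1,\infty)$, one has $\dim_H(\mu) \le d_*(\mu) \le d_p^*(\mu) \le \dim_M(\mu)$, where $\dim_H(\mu)$ and $\dim_M(\mu)$ are the Hausdorff and Minkowski dimensions of $\mu$. -/
open MeasureTheory Filter Topology Metric Set
open scoped ENNReal NNReal

/-! ### Comparison of dimensions -/

lemma elog2_mono : Monotone elog2 := by
  intro m n h
  unfold elog2
  by_cases hn : n = ⊤
  · simp [hn]
  have hm : m ≠ ⊤ := ne_top_of_le_ne_top hn h
  rw [if_neg hm, if_neg hn]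
  apply ENNReal.ofReal_le_ofReal
  have hmn : m.toNat ≤ n.toNat := ENat.toNat_le_toNat h hn
  rcases Nat.eq_zero_or_pos m.toNat with h0 | h0
  · rw [h0]
    rcases Nat.eq_zero_or_pos n.toNat with h1 | h1
    · simp [h1]
    · simpa using Real.logb_nonneg one_lt_two (by exact_mod_cast h1)
  · exact Real.logb_le_logb_of_le one_lt_two (by exact_mod_cast h0) (by exact_mod_cast hmn)

lemma measureCoveringNumber_antitone {E : Type*} [PseudoMetricSpace E] [MeasurableSpace E]
    (ε : ℝ) (μ : Measure E) : Antitone (fun δ => measureCoveringNumber ε δ μ) := by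
  intro δ δ' h
  refine le_iInf₂ fun S hS => iInf_le_of_le S (iInf_le_of_le (le_trans ?_ hS) le_rfl)
  gcongr

lemma measureCoveringNumber_le_coveringNumber {E : Type*} [PseudoMetricSpace E]
    [MeasurableSpace E] (ε δ : ℝ) {μ : Measure E} {S : Set E} (hS : μ S = 1) :
    measureCoveringNumber ε δ μ ≤ coveringNumber ε S :=
  iInf₂_le S (by rw [hS]; exact tsub_le_self)

lemma upperDim_le_measureDimM {E : Type*} [PseudoMetricSpace E] [MeasurableSpace E]
    (r : ℝ) (μ : Measure E) : upperDim r μ ≤ measureDimM μ := by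
  refine le_iInf₂ fun S hS => limsup_le_limsup (Eventually.of_forall fun ε => ?_)
  exact ENNReal.div_le_div_right
    (elog2_mono (measureCoveringNumber_le_coveringNumber ε (ε ^ r) hS)) _

lemma lowerDim_le_upperDim {E : Type*} [PseudoMetricSpace E] [MeasurableSpace E]
    {r : ℝ} (hr : 0 < r) (μ : Measure E) : lowerDim μ ≤ upperDim r μ := by
  refine iSup₂_le fun δ hδ => (liminf_le_limsup).trans (limsup_le_limsup ?_)
  have hlim : Tendsto (fun ε : ℝ => ε ^ r) (𝓝[>] 0) (𝓝 0) := by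
    have h := (Real.continuousAt_rpow_const 0 r (Or.inr hr.le)).tendsto
    rw [Real.zero_rpow hr.ne'] at h
    exact h.mono_left nhdsWithin_le_nhds
  filter_upwards [hlim.eventually (eventually_le_nhds hδ)] with ε hε
  exact ENNReal.div_le_div_right (elog2_mono (measureCoveringNumber_antitone ε μ hε)) _

/-- A bound `log₂ n / (-log₂ ε) < s` means that `n` is finite with `n * ε ^ s ≤ 1`. -/
lemma natCast_mul_rpow_le_one {n : ℕ∞} {ε : ℝ} (h0 : 0 < ε) (h1 : ε < 1) {s : ℝ≥0}
    (h : elog2 n / ENNReal.ofReal (-Real.logb 2 ε) < s) :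
    n ≠ ⊤ ∧ (n.toNat : ℝ) * ε ^ (s : ℝ) ≤ 1 := by
  have hlog : 0 < -Real.logb 2 ε := neg_pos.2 (Real.logb_neg one_lt_two h0 h1)
  rw [ENNReal.div_lt_iff (Or.inl (by simpa using hlog)) (Or.inl ENNReal.ofReal_ne_top)] at h
  have hn : n ≠ ⊤ := by
    rintro rfl
    simp [elog2] at h
  refine ⟨hn, ?_⟩
  rcases Nat.eq_zero_or_pos n.toNat with hz | hz
  · simp [hz]
  have hz' : (0 : ℝ) < n.toNat := by exact_mod_cast hz
  rw [elog2, if_neg hn, ← ENNReal.ofReal_coe_nnreal, ← ENNReal.ofReal_mul s.coe_nonneg] at h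
  have h' := (ENNReal.ofReal_le_ofReal_iff (mul_nonneg s.coe_nonneg hlog.le)).1 h.le
  rw [← Real.logb_nonpos_iff one_lt_two (by positivity),
    Real.logb_mul hz'.ne' (by positivity), Real.logb_rpow_eq_mul_logb_of_pos h0]
  linarith

lemma exists_finset_cover_of_lowerDim_lt {E : Type*} [PseudoMetricSpace E] [MeasurableSpace E]
    {μ : Measure E} {s : ℝ≥0} (h : lowerDim μ < s) {δ ρ : ℝ} (hδ : 0 < δ) (hρ : 0 < ρ) :
    ∃ ε : ℝ, 0 < ε ∧ ε < ρ ∧ ∃ t : Finset E,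
      1 - ENNReal.ofReal δ ≤ μ (⋃ x ∈ t, Metric.ball x ε) ∧ (t.card : ℝ) * ε ^ (s : ℝ) ≤ 1 := by
  have hlim := (le_iSup₂ (f := fun (δ : ℝ) (_ : 0 < δ) => Filter.liminf
      (fun ε : ℝ => elog2 (measureCoveringNumber ε δ μ) / ENNReal.ofReal (-Real.logb 2 ε))
      (𝓝[>] (0 : ℝ))) δ hδ).trans_lt h
  have hsmall : ∀ᶠ ε : ℝ in 𝓝[>] 0, ε ∈ Ioo 0 (min ρ 1) :=
    Ioo_mem_nhdsGT (by positivity)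
  obtain ⟨ε, hε, hε0, hε1⟩ :=
    ((frequently_lt_of_liminf_lt isCobounded_ge_of_top hlim).and_eventually hsmall).exists
  obtain ⟨hn, hle⟩ := natCast_mul_rpow_le_one hε0 (hε1.trans_le (min_le_right _ _)) hε
  have hlt : measureCoveringNumber ε δ μ < measureCoveringNumber ε δ μ + 1 :=
    (ENat.lt_add_one_iff hn).2 le_rfl
  conv_lhs at hlt => unfold measureCoveringNumber _root_.coveringNumber
  simp only [iInf_lt_iff] at hlt
  obtain ⟨S, hS, t, ht, hcard⟩ := hlt
  refine ⟨ε, hε0, hε1.trans_le (min_le_left _ _), t, hS.trans (measure_mono ht), le_trans ?_ hle⟩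
  gcongr
  simpa using ENat.toNat_le_toNat ((ENat.lt_add_one_iff hn).1 hcard) hn

/-- If `A` is covered, at arbitrarily small scales `ε`, by `N` balls of radius `ε` with
`N * ε ^ s ≤ 1`, then its Hausdorff dimension is at most `s`. -/
lemma dimH_le_of_forall_cover {E : Type*} [MetricSpace E] {A : Set E} {s : ℝ≥0}
    {ε : ℕ → ℝ} (hε0 : ∀ n, 0 < ε n) (hε : Tendsto ε atTop (𝓝 0)) {t : ℕ → Finset E}
    (hcov : ∀ᶠ n in atTop, A ⊆ ⋃ x ∈ t n, Metric.ball x (ε n))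
    (hcard : ∀ n, ((t n).card : ℝ) * ε n ^ (s : ℝ) ≤ 1) : dimH A ≤ s := by
  borelize E
  have hdiam : ∀ n (x : E), ediam (Metric.ball x (ε n)) ≤ 2 * ENNReal.ofReal (ε n) := by
    intro n x
    rw [← Metric.eball_ofReal]
    exact Metric.ediam_eball_le
  have hr : Tendsto (fun n => 2 * ENNReal.ofReal (ε n)) atTop (𝓝 0) := by
    have h := ENNReal.Tendsto.const_mul (a := 2) (ENNReal.tendsto_ofReal hε) (Or.inr (by simp))
    simpa using h
  have hsum : ∀ n, ∑ x : t n, ediam (Metric.ball (x : E) (ε n)) ^ (s : ℝ) ≤ 2 ^ (s : ℝ) := by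
    intro n
    calc ∑ x : t n, ediam (Metric.ball (x : E) (ε n)) ^ (s : ℝ)
        ≤ ∑ _x : t n, (2 * ENNReal.ofReal (ε n)) ^ (s : ℝ) :=
          Finset.sum_le_sum fun x _ => ENNReal.rpow_le_rpow (hdiam n x) s.coe_nonneg
      _ = 2 ^ (s : ℝ) * ENNReal.ofReal ((t n).card * ε n ^ (s : ℝ)) := by
          rw [Finset.sum_const, Finset.card_univ, Fintype.card_coe, nsmul_eq_mul,
            ENNReal.mul_rpow_of_nonneg _ _ s.coe_nonneg, ENNReal.ofReal_rpow_of_pos (hε0 n),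
            ENNReal.ofReal_mul (by positivity), ENNReal.ofReal_natCast]
          ring
      _ ≤ 2 ^ (s : ℝ) * 1 := by
          gcongr
          exact ENNReal.ofReal_le_one.2 (hcard n)
      _ = 2 ^ (s : ℝ) := mul_one _
  refine dimH_le_of_hausdorffMeasure_ne_top (ne_top_of_le_ne_top
    (ENNReal.rpow_ne_top_of_nonneg s.coe_nonneg (ENNReal.ofNat_ne_top (n := 2))) ?_)
  refine (Measure.hausdorffMeasure_le_liminf_sum s A _ hr
    (fun n (x : t n) => Metric.ball (x : E) (ε n))
    (Eventually.of_forall fun n x => hdiam n x) ?_).trans ?_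
  · filter_upwards [hcov] with n hn
    exact hn.trans (iUnion₂_subset fun x hx => subset_iUnion_of_subset ⟨x, hx⟩ subset_rfl)
  · exact (liminf_le_limsup).trans (limsup_le_of_le (h := Eventually.of_forall hsum))

lemma measureDimH_le_lowerDim {E : Type*} [MetricSpace E] [MeasurableSpace E]
    [OpensMeasurableSpace E] (μ : Measure E) [IsProbabilityMeasure μ] :
    measureDimH μ ≤ lowerDim μ := by
  refine le_of_forall_gt_imp_ge_of_dense fun c hc => ?_
  induction c with
  | top => exact le_top
  | coe s =>
  choose ε hε0 hε t hμ hcard using fun n : ℕ => exists_finset_cover_of_lowerDim_lt hc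
    (δ := (1 / 2) ^ n) (ρ := 1 / ((n : ℝ) + 1)) (by positivity) (by positivity)
  set U : ℕ → Set E := fun n => ⋃ x ∈ t n, Metric.ball x (ε n)
  have hU : ∀ n, MeasurableSet (U n) := fun n =>
    (t n).measurableSet_biUnion fun x _ => measurableSet_ball
  have hcompl : ∀ n, μ (U n)ᶜ ≤ (1 / 2 : ℝ≥0∞) ^ n := by
    intro n
    rw [prob_compl_eq_one_sub (hU n), tsub_le_iff_left, ← tsub_le_iff_right]
    refine le_trans (le_of_eq ?_) (hμ n)
    rw [ENNReal.ofReal_pow (by positivity), ENNReal.ofReal_div_of_pos two_pos]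
    simp
  have hfin : ∑' n, μ (U n)ᶜ ≠ ⊤ := by
    refine ne_top_of_le_ne_top ?_ (ENNReal.tsum_le_tsum hcompl)
    rw [ENNReal.tsum_geometric, one_div, ENNReal.one_sub_inv_two, inv_inv]
    exact ENNReal.ofNat_ne_top
  have hae : μ (⋃ m, ⋂ n ≥ m, U n) = 1 := by
    rw [← mem_ae_iff_prob_eq_one (MeasurableSet.iUnion fun m => MeasurableSet.iInter fun n =>
      MeasurableSet.iInter fun _ => hU n)]
    filter_upwards [ae_eventually_notMem hfin] with x hx
    obtain ⟨m, hm⟩ := eventually_atTop.1 hx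
    exact mem_iUnion.2 ⟨m, mem_iInter₂.2 fun n hn => notMem_compl_iff.1 (hm n hn)⟩
  refine iInf_le_of_le _ (iInf_le_of_le hae ?_)
  rw [dimH_iUnion]
  refine iSup_le fun m => dimH_le_of_forall_cover hε0 ?_ ?_ hcard
  · exact squeeze_zero (fun n => (hε0 n).le) (fun n => (hε n).le)
      tendsto_one_div_add_atTop_nhds_zero_nat
  · filter_upwards [eventually_ge_atTop m] with n hn
    exact biInter_subset_of_mem hn

/-- Proposition: comparison of the dimensions of a measure. -/
theorem statement1 (d : ℕ) (p : ℝ) (hp : 1 ≤ p)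
    (μ : Measure (EuclideanSpace ℝ (Fin d))) [IsProbabilityMeasure μ] :
    measureDimH μ ≤ lowerDim μ ∧ lowerDim μ ≤ upperDim p μ ∧ upperDim p μ ≤ measureDimM μ := by
  exact ⟨measureDimH_le_lowerDim μ, lowerDim_le_upperDim (by linarith) μ,
    upperDim_le_measureDimM p μ⟩
end

section
/- Let $p \in [1,\infty)$ and let $\nu$ be an absolutely continuous probability distribution on $\mathbb{R}$. Suppose $\mu$ is a probability measure on $\mathbb{R}^d$ with finite absolute $q$-moment $M_q(\mu) < \infty$ for some $q > p$. If $s > d^*_{pq/(q-p)}(\mu)$, then for all sufficiently large $W$ and $L$, $\inf_{\phi \in \mathcal{NN}(W,L)} W_p(\mu, \phi_\# \nu) \le C d^{1/s} (M_q^p(\mu)+1)^{1/p} (W^2 L)^{-1/s}$, where $C \le 384$ is a universal constant. -/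
open MeasureTheory Filter Topology Metric Set
open scoped ENNReal NNReal

/-- Hidden layers of a ReLU network with scalar input, with all indices in `ℕ`. -/
def natForward (N : ℕ → ℕ) (A : ℕ → ℕ → ℕ → ℝ) (b : ℕ → ℕ → ℝ) : ℕ → ℝ → ℕ → ℝ
  | 0 => fun x _ => x
  | l + 1 => fun x i => max (∑ j ∈ Finset.range (N l), A l i j * natForward N A b l x j + b l i) 0

theorem natForward_congr {N N' : ℕ → ℕ} {A A' : ℕ → ℕ → ℕ → ℝ} {b b' : ℕ → ℕ → ℝ} {l : ℕ}
    (hN : ∀ j < l, N j = N' j) (hA : ∀ j < l, A j = A' j) (hb : ∀ j < l, b j = b' j) :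
    natForward N A b l = natForward N' A' b' l := by
  induction l with
  | zero => rfl
  | succ l ih =>
    have h := ih (fun j hj => hN j (by omega)) (fun j hj => hA j (by omega))
      (fun j hj => hb j (by omega))
    funext x i
    simp only [natForward, h, hN l (by omega), hA l (by omega), hb l (by omega)]

theorem nnForward_eq_natForward (N : ℕ → ℕ) (A : ℕ → ℕ → ℕ → ℝ) (b : ℕ → ℕ → ℝ) (l : ℕ) (x : ℝ)
    (i : Fin (N l)) :
    nnForward N (fun l => Matrix.of fun i j => A l i j) (fun l i => b l i) l (fun _ => x) i
      = natForward N A b l x i := by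
  induction l with
  | zero => rfl
  | succ l ih =>
    simp only [nnForward, natForward, Matrix.mulVec, dotProduct, Matrix.of_apply, ih]
    rw [Finset.sum_range]

/-- `g` is, up to relabelling of neurons, the `l`-th hidden layer of a ReLU network with scalar
input and width at most `W`. -/
def IsHiddenLayer (W l : ℕ) {ι : Type} (g : ℝ → ι → ℝ) : Prop :=
  ∃ (N : ℕ → ℕ) (A : ℕ → ℕ → ℕ → ℝ) (b : ℕ → ℕ → ℝ),
    N 0 = 1 ∧ (∀ j, 1 ≤ j → j ≤ l → N j ≤ W) ∧
      ∃ e : ι ≃ Fin (N l), ∀ x i, natForward N A b l x (e i) = g x i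

/-- The functions that are affine combinations of the components of `g`. -/
def outputSpan {ι : Type} (g : ℝ → ι → ℝ) : Submodule ℝ (ℝ → ℝ) :=
  Submodule.span ℝ (Set.range fun o : Option ι => o.elim (fun _ => 1) fun i x => g x i)

theorem coord_mem_outputSpan {ι : Type} (g : ℝ → ι → ℝ) (i : ι) :
    (fun x => g x i) ∈ outputSpan g :=
  Submodule.subset_span ⟨some i, rfl⟩

theorem const_mem_outputSpan {ι : Type} (g : ℝ → ι → ℝ) (c : ℝ) :
    (fun _ => c) ∈ outputSpan g := by
  have h : (fun _ => (1 : ℝ)) ∈ outputSpan g := Submodule.subset_span ⟨none, rfl⟩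
  simpa [Pi.smul_def] using Submodule.smul_mem _ c h

theorem exists_of_mem_outputSpan {ι : Type} [Fintype ι] {g : ℝ → ι → ℝ} {u : ℝ → ℝ}
    (hu : u ∈ outputSpan g) : ∃ (a : ι → ℝ) (b : ℝ), ∀ x, u x = ∑ i, a i * g x i + b := by
  obtain ⟨c, rfl⟩ := (Submodule.mem_span_range_iff_exists_fun ℝ).1 hu
  refine ⟨fun i => c (some i), c none, fun x => ?_⟩
  simp [Fintype.sum_option, add_comm]

theorem isHiddenLayer_zero (W : ℕ) : IsHiddenLayer W 0 (fun x (_ : Unit) => x) :=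
  ⟨fun _ => 1, fun _ _ _ => 0, fun _ _ => 0, rfl, by omega, Equiv.ofUnique _ _, fun _ _ => rfl⟩

theorem IsHiddenLayer.succ {W l : ℕ} {ι κ : Type} [Fintype ι] [Fintype κ] {g : ℝ → ι → ℝ}
    (hg : IsHiddenLayer W l g) (hκ : Fintype.card κ ≤ W) {u : κ → ℝ → ℝ}
    (hu : ∀ k, u k ∈ outputSpan g) : IsHiddenLayer W (l + 1) fun x k => max (u k x) 0 := by
  obtain ⟨N, A, b, h0, hN, e, he⟩ := hg
  choose a c hac using fun k => exists_of_mem_outputSpan (hu k)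
  set n := Fintype.card κ
  have f : κ ≃ Fin n := Fintype.equivFin κ
  let A' : ℕ → ℕ → ℝ := fun i j =>
    if h : i < n ∧ j < N l then a (f.symm ⟨i, h.1⟩) (e.symm ⟨j, h.2⟩) else 0
  let c' : ℕ → ℝ := fun i => if h : i < n then c (f.symm ⟨i, h⟩) else 0
  have hn : n = Function.update N (l + 1) n (l + 1) := by simp
  refine ⟨Function.update N (l + 1) n, Function.update A l A', Function.update b l c', ?_, ?_,
    f.trans (finCongr hn), fun x k => ?_⟩
  · simpa using h0
  · intro j hj hjl
    rcases eq_or_ne j (l + 1) with rfl | hne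
    · simpa using hκ
    · rw [Function.update_of_ne hne]
      exact hN j hj (by omega)
  · have hF : natForward (Function.update N (l + 1) n) (Function.update A l A')
        (Function.update b l c') l = natForward N A b l :=
      natForward_congr (fun j hj => Function.update_of_ne (by omega) _ _)
        (fun j hj => Function.update_of_ne (by omega) _ _)
        (fun j hj => Function.update_of_ne (by omega) _ _)
    simp only [natForward, hF, hac]
    rw [Function.update_of_ne (show l ≠ l + 1 by omega), Finset.sum_range]
    have hc : c' (f k) = c k := by simp [c']
    have hA : ∑ j : Fin (N l), A' (f k) j * natForward N A b l x j = ∑ i, a k i * g x i := by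
      rw [← e.sum_comp]
      refine Finset.sum_congr rfl fun i _ => ?_
      simp [A', he]
    simp [hc, hA]

theorem IsHiddenLayer.mem_NNset1 {W L l d : ℕ} {ι : Type} [Fintype ι] {g : ℝ → ι → ℝ}
    (hg : IsHiddenLayer W l g) (hl : 1 ≤ l) (hL : l ≤ L) {u : Fin d → ℝ → ℝ}
    (hu : ∀ c, u c ∈ outputSpan g) :
    (fun x => WithLp.toLp 2 fun c => u c x) ∈ NNset1 d W L := by
  obtain ⟨N, A, b, h0, hN, e, he⟩ := hg
  choose a c hac using fun k => exists_of_mem_outputSpan (hu k)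
  let A' : ℕ → ℕ → ℝ := fun i j =>
    if h : i < d ∧ j < N l then a ⟨i, h.1⟩ (e.symm ⟨j, h.2⟩) else 0
  let c' : ℕ → ℝ := fun i => if h : i < d then c ⟨i, h⟩ else 0
  refine ⟨l, hl, hL, Function.update N (l + 1) d, by simpa using h0, by simp, ?_,
    fun l' => Matrix.of fun i j => Function.update A l A' l' i j,
    fun l' i => Function.update b l c' l' i, fun x i => ?_⟩
  · intro j hj hjl
    rw [Function.update_of_ne (by omega)]
    exact hN j hj hjl
  · have hF : natForward (Function.update N (l + 1) d) (Function.update A l A')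
        (Function.update b l c') l = natForward N A b l :=
      natForward_congr (fun j hj => Function.update_of_ne (by omega) _ _)
        (fun j hj => Function.update_of_ne (by omega) _ _)
        (fun j hj => Function.update_of_ne (by omega) _ _)
    have hx : (fun j => x (Fin.cast (by simpa using h0) j)) =
        fun _ : Fin (Function.update N (l + 1) d 0) => x 0 := by
      funext j
      rw [Subsingleton.elim (Fin.cast _ j) 0]
    rw [hx]
    simp only [Matrix.mulVec, dotProduct, Matrix.of_apply, nnForward_eq_natForward, hF, hac]
    rw [← Finset.sum_range fun j => Function.update A l A' l _ j * natForward N A b l (x 0) j,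
      Function.update_of_ne (show l ≠ l + 1 by omega), Finset.sum_range]
    have hc : c' i = c i := by simp [c']
    have hA : ∑ j : Fin (N l), A' i j * natForward N A b l (x 0) j = ∑ k, a i k * g (x 0) k := by
      rw [← e.sum_comp]
      refine Finset.sum_congr rfl fun k _ => ?_
      simp [A', he]
    simp [hc, hA]

theorem continuous_nnForward (N : ℕ → ℕ) (M : ∀ l : ℕ, Matrix (Fin (N (l + 1))) (Fin (N l)) ℝ)
    (b : ∀ l : ℕ, Fin (N (l + 1)) → ℝ) (l : ℕ) : Continuous (nnForward N M b l) := by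
  induction l with
  | zero => exact continuous_id
  | succ l ih =>
    refine continuous_pi fun i => ?_
    simp only [nnForward, Matrix.mulVec, dotProduct]
    fun_prop

theorem continuous_of_mem_NNset1 {d W L : ℕ} {φ : ℝ → EuclideanSpace ℝ (Fin d)}
    (hφ : φ ∈ NNset1 d W L) : Continuous φ := by
  obtain ⟨l, -, -, N, h0, hL, -, M, b, h⟩ := hφ
  have hc : Continuous fun x i => φ x i := by
    refine continuous_pi fun i => ?_
    have hx (x : ℝ) := h (WithLp.toLp 2 fun _ => x) i
    have := continuous_nnForward N M b l
    simp only [Matrix.mulVec, dotProduct] at hx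
    simp only [hx]
    fun_prop
  exact (PiLp.continuous_toLp 2 _).comp hc

/-- Coefficients `a` such that `∑ r, a r * max (x - t r) 0`, with `t = ![u, u + γ, v - γ, v]`, is
equal to `m * x + c` on `[u + γ, v - γ]` and vanishes outside `[u, v]`. -/
noncomputable def gateCoeff (γ u v m c : ℝ) : Fin 4 → ℝ :=
  ![(m * (u + γ) + c) / γ, m - (m * (u + γ) + c) / γ, -(m * (v - γ) + c) / γ - m,
    (m * (v - γ) + c) / γ]

theorem sum_gateCoeff {γ : ℝ} (hγ : 0 < γ) {u v : ℝ} (huv : u ≤ v) (m c x : ℝ) {P : Prop}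
    [Decidable P] (hP : P → u + γ ≤ x ∧ x ≤ v - γ) (hnP : ¬P → x ≤ u - γ ∨ v + γ ≤ x) :
    ∑ r, gateCoeff γ u v m c r * max (x - ![u, u + γ, v - γ, v] r) 0
      = if P then m * x + c else 0 := by
  simp only [Fin.sum_univ_four, gateCoeff, Matrix.cons_val]
  split_ifs with h
  · obtain ⟨h1, h2⟩ := hP h
    rw [max_eq_left (by linarith), max_eq_left (by linarith), max_eq_right (by linarith),
      max_eq_right (by linarith)]
    field_simp
    ring
  · rcases hnP h with h1 | h1
    · rw [max_eq_right (by linarith), max_eq_right (by linarith), max_eq_right (by linarith),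
        max_eq_right (by linarith)]
      ring
    · rw [max_eq_left (by linarith), max_eq_left (by linarith), max_eq_left (by linarith),
        max_eq_left (by linarith)]
      field_simp
      ring

theorem ramp_sub_ramp {γ Y q x : ℝ} (hγ : 0 < γ) (hY : 0 ≤ Y) {P : Prop} [Decidable P]
    (hP : P → q + γ ≤ x) (hnP : ¬P → x ≤ q - γ) :
    max (Y / (2 * γ) * x + -(Y / (2 * γ) * (q - γ))) 0
      - max (Y / (2 * γ) * x + -(Y / (2 * γ) * (q + γ))) 0 = if P then Y else 0 := by
  have hm : 0 ≤ Y / (2 * γ) := by positivity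
  split_ifs with h
  · have := hP h
    rw [max_eq_left (by nlinarith), max_eq_left (by nlinarith)]
    field_simp
    ring
  · have := hnP h
    rw [max_eq_right (by nlinarith), max_eq_right (by nlinarith), sub_zero]

/-- Three layers of width `O(w)` suffice to add the values of a step function with `w * w` pieces
to an accumulator. Component `none` of the layers carries the input. -/
theorem IsHiddenLayer.exists_add_steps {W l d w : ℕ} (hw : d + 1 + 4 * (w * (d + 1)) ≤ W)
    (hw0 : 0 < w) {g : ℝ → Option (Fin d) → ℝ} (hg : IsHiddenLayer W l g)
    {q : ℕ → ℝ} (hq : Monotone q)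
    {γ : ℝ} (hγ : 0 < γ) {y : ℕ → Fin d → ℝ} (hy : ∀ i c, 0 ≤ y i c) (b : ℕ) :
    ∃ g' : ℝ → Option (Fin d) → ℝ, IsHiddenLayer W (l + 3) g' ∧
      ∀ i x, q i + γ ≤ x → x ≤ q (i + 1) - γ → g x none = x - q 0 → (∀ c, 0 ≤ g x (some c)) →
        g' x none = x - q 0 ∧
          ∀ c, g' x (some c) = g x (some c) + if i / w / w = b then y i c else 0 := by
  let u (j : ℕ) : ℝ := q ((b * w + j) * w)
  let v (j : ℕ) : ℝ := q ((b * w + j + 1) * w)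
  let u1 : Option (Fin d) ⊕ (Fin w × Fin 4) → ℝ → ℝ := Sum.elim (fun o x => g x o)
    fun jr x => g x none + (q 0 - ![u jr.1, u jr.1 + γ, v jr.1 - γ, v jr.1] jr.2)
  have h1 := hg.succ (W := W) (u := u1)
    (by simp only [Fintype.card_sum, Fintype.card_option, Fintype.card_fin, Fintype.card_prod]
        nlinarith) (by
      rintro (o | ⟨j, r⟩)
      · exact coord_mem_outputSpan g o
      · exact Submodule.add_mem _ (coord_mem_outputSpan g none) (const_mem_outputSpan g _))
  let Y (k : ℕ) (j : ℕ) (c : Fin d) : ℝ := y ((b * w + j) * w + k) c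
  let S (k : ℕ) (j : ℕ) : Fin 4 → ℝ :=
    ![q ((b * w + j) * w + k) - γ, q ((b * w + j) * w + k) + γ,
      q ((b * w + j) * w + k + 1) - γ, q ((b * w + j) * w + k + 1) + γ]
  let u2 : Option (Fin d) ⊕ (Fin w × Fin d × Fin 4) → ℝ → ℝ := Sum.elim
    (fun o x => max (u1 (Sum.inl o) x) 0)
    fun a x => ∑ j : Fin w, ∑ r, gateCoeff γ (u j) (v j) (Y a.1 j a.2.1 / (2 * γ))
      (-(Y a.1 j a.2.1 / (2 * γ) * S a.1 j a.2.2)) r * max (u1 (Sum.inr (j, r)) x) 0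
  have h2 := h1.succ (W := W) (u := u2)
    (by simp only [Fintype.card_sum, Fintype.card_option, Fintype.card_fin, Fintype.card_prod]
        nlinarith) (by
      rintro (o | a)
      · exact coord_mem_outputSpan (fun x k => max (u1 k x) 0) (Sum.inl o)
      · convert! Submodule.sum_mem (outputSpan fun x k => max (u1 k x) 0) (t := Finset.univ)
          fun (j : Fin w) _ => Submodule.sum_mem _ (t := Finset.univ) fun (r : Fin 4) _ =>
            Submodule.smul_mem _ (gateCoeff γ (u j) (v j) (Y a.1 j a.2.1 / (2 * γ))
              (-(Y a.1 j a.2.1 / (2 * γ) * S a.1 j a.2.2)) r)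
              (coord_mem_outputSpan (fun x k => max (u1 k x) 0) (Sum.inr (j, r))) using 1
        funext x
        simp [u2])
  let u3 : Option (Fin d) → ℝ → ℝ := fun o => o.elim (fun x => max (u2 (Sum.inl none) x) 0)
    fun c x => max (u2 (Sum.inl (some c)) x) 0 + ∑ k : Fin w,
      (max (u2 (Sum.inr (k, c, 0)) x) 0 - max (u2 (Sum.inr (k, c, 1)) x) 0
        - (max (u2 (Sum.inr (k, c, 2)) x) 0 - max (u2 (Sum.inr (k, c, 3)) x) 0))
  have h3 := h2.succ (W := W) (u := u3)
    (by simp only [Fintype.card_option, Fintype.card_fin]; omega) (by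
      have hc := coord_mem_outputSpan fun x k => max (u2 k x) 0
      rintro (_ | c)
      · exact hc _
      · refine Submodule.add_mem _ (hc _) ?_
        convert! Submodule.sum_mem (outputSpan fun x k => max (u2 k x) 0) (t := Finset.univ)
          fun (k : Fin w) _ => Submodule.sub_mem _
            (Submodule.sub_mem _ (hc (Sum.inr (k, c, 0))) (hc (Sum.inr (k, c, 1))))
            (Submodule.sub_mem _ (hc (Sum.inr (k, c, 2))) (hc (Sum.inr (k, c, 3)))) using 1
        funext x
        simp)
  refine ⟨_, h3, fun i x hx1 hx2 hx0 hxc => ?_⟩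
  have hle : ∀ m, m ≤ i → q m + γ ≤ x := fun m hm => by linarith [hq hm]
  have hgt : ∀ m, ¬m ≤ i → x ≤ q m - γ := fun m hm => by
    linarith [hq (show i + 1 ≤ m by omega)]
  have hu2 (k : Fin w) (c : Fin d) (r : Fin 4) : u2 (Sum.inr (k, c, r)) x =
      ∑ j : Fin w, if b * w + j = i / w then
        Y k j c / (2 * γ) * x + -(Y k j c / (2 * γ) * S k j r) else 0 := by
    refine Finset.sum_congr rfl fun j _ => ?_
    have huv : u j ≤ v j := hq (Nat.mul_le_mul_right _ (by omega))
    rw [← sum_gateCoeff hγ huv (Y k j c / (2 * γ)) (-(Y k j c / (2 * γ) * S k j r)) x]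
    · refine Finset.sum_congr rfl fun r' _ => ?_
      simp only [u1, Sum.elim_inr, hx0]
      congr 2
      ring
    · intro h
      refine ⟨hle _ ?_, hgt _ ?_⟩
      · exact (Nat.le_div_iff_mul_le hw0).1 h.le
      · rw [← Nat.le_div_iff_mul_le hw0]
        omega
    · intro h
      rcases Nat.lt_or_gt_of_ne h with h | h
      · exact Or.inr (hle _ ((Nat.le_div_iff_mul_le hw0).1 h))
      · refine Or.inl (hgt _ ?_)
        rw [← Nat.le_div_iff_mul_le hw0]
        omega
  refine ⟨?_, fun c => ?_⟩
  · have : 0 ≤ x - q 0 := by linarith [hle 0 (Nat.zero_le _)]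
    simp [u3, u2, u1, hx0, this]
  have hsum : ∑ k : Fin w,
      (max (u2 (Sum.inr (k, c, 0)) x) 0 - max (u2 (Sum.inr (k, c, 1)) x) 0
        - (max (u2 (Sum.inr (k, c, 2)) x) 0 - max (u2 (Sum.inr (k, c, 3)) x) 0))
      = if i / w / w = b then y i c else 0 := by
    split_ifs with hb
    · have hj0 : i / w - b * w < w := by
        have := Nat.div_add_mod (i / w) w
        have := Nat.mod_lt (i / w) hw0
        rw [hb] at *
        have := mul_comm b w
        omega
      have hbw : b * w ≤ i / w := (Nat.le_div_iff_mul_le hw0).1 hb.ge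
      have hu2' (k : Fin w) (r : Fin 4) : u2 (Sum.inr (k, c, r)) x =
          Y k (i / w - b * w) c / (2 * γ) * x
            + -(Y k (i / w - b * w) c / (2 * γ) * S k (i / w - b * w) r) := by
        rw [hu2, Finset.sum_eq_single ⟨_, hj0⟩]
        · simp only
          rw [if_pos (by omega)]
        · rintro ⟨j, hj⟩ - hne
          rw [if_neg]
          simp only [ne_eq, Fin.mk.injEq] at hne ⊢
          omega
        · simp
      have hdm : i / w * w + i % w = i := Nat.div_add_mod' i w
      rw [Finset.sum_eq_single ⟨i % w, Nat.mod_lt _ hw0⟩]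
      · simp only [hu2', S, Y, Matrix.cons_val]
        rw [ramp_sub_ramp hγ (hy _ _) (hle _) (hgt _), ramp_sub_ramp hγ (hy _ _) (hle _) (hgt _)]
        simp [Nat.add_sub_cancel' hbw, hdm]
      · rintro ⟨k, hk⟩ - hne
        simp only [hu2', S, Y, Matrix.cons_val]
        rw [ramp_sub_ramp hγ (hy _ _) (hle _) (hgt _), ramp_sub_ramp hγ (hy _ _) (hle _) (hgt _)]
        simp only [Nat.add_sub_cancel' hbw]
        simp only [ne_eq, Fin.mk.injEq] at hne
        by_cases hki : i / w * w + k ≤ i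
        · rw [if_pos hki, if_pos (by omega), sub_self]
        · rw [if_neg hki, if_neg (by omega), sub_self]
      · simp
    · refine Finset.sum_eq_zero fun k _ => ?_
      have hu2' (r : Fin 4) : u2 (Sum.inr (k, c, r)) x = 0 := by
        rw [hu2]
        refine Finset.sum_eq_zero fun j _ => if_neg fun h => hb ?_
        rw [← h, mul_comm, Nat.mul_add_div j.pos, Nat.div_eq_of_lt j.2, add_zero]
      simp [hu2']
  have hnn : 0 ≤ if i / w / w = b then y i c else 0 := by split_ifs <;> simp [hy]
  simp only [u3, Option.elim]
  rw [hsum]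
  simp only [u2, u1, Sum.elim_inl, max_eq_left (hxc c)]
  rw [max_eq_left (add_nonneg (hxc c) hnn)]

theorem exists_mem_NNset1_eq_on_steps {W L d w K : ℕ} (hw : d + 1 + 4 * (w * (d + 1)) ≤ W)
    (hw0 : 0 < w) (hdW : 2 * d ≤ W)
    (hK : 3 * K + 2 ≤ L) {q : ℕ → ℝ} (hq : Monotone q) {γ : ℝ} (hγ : 0 < γ) {R : ℝ}
    {y : ℕ → EuclideanSpace ℝ (Fin d)} (hy : ∀ i c, |y i c| ≤ R) :
    ∃ φ ∈ NNset1 d W L, (∀ x c, |φ x c| ≤ R) ∧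
      ∀ i < K * w * w, ∀ x, q i + γ ≤ x → x ≤ q (i + 1) - γ → φ x = y i := by
  have hR : 0 ≤ R ∨ IsEmpty (Fin d) := by
    rcases isEmpty_or_nonempty (Fin d) with h | ⟨⟨c⟩⟩
    · exact Or.inr h
    · exact Or.inl ((abs_nonneg _).trans (hy 0 c))
  have hy' (i c) : 0 ≤ y i c + R := by linarith [(abs_le.1 (hy i c)).1]
  have key : ∀ K, ∃ g : ℝ → Option (Fin d) → ℝ, IsHiddenLayer W (1 + 3 * K) g ∧
      ∀ i x, q i + γ ≤ x → x ≤ q (i + 1) - γ → g x none = x - q 0 ∧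
        ∀ c, g x (some c) = if i / w / w < K then y i c + R else 0 := by
    intro K
    induction K with
    | zero =>
      let u : Option (Fin d) → ℝ → ℝ := fun o => o.elim (fun x => x + -q 0) fun _ _ => 0
      refine ⟨_, (isHiddenLayer_zero W).succ (u := u) ?_ ?_, fun i x hx1 hx2 => ⟨?_, fun c => ?_⟩⟩
      · simp only [Fintype.card_option, Fintype.card_fin]
        omega
      · rintro (_ | c)
        · exact Submodule.add_mem _ (coord_mem_outputSpan _ ()) (const_mem_outputSpan _ _)
        · exact const_mem_outputSpan _ _
      · have : q 0 ≤ x := by linarith [hq (Nat.zero_le i)]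
        simp [u, ← sub_eq_add_neg, this]
      · simp [u]
    | succ K ih =>
      obtain ⟨g, hg, h⟩ := ih
      obtain ⟨g', hg', h'⟩ := hg.exists_add_steps hw hw0 hq hγ hy' K
      refine ⟨g', hg', fun i x hx1 hx2 => ?_⟩
      obtain ⟨h0, hc⟩ := h i x hx1 hx2
      obtain ⟨h0', hc'⟩ := h' i x hx1 hx2 h0 fun c => by
        rw [hc]
        split_ifs <;> simp [hy']
      refine ⟨h0', fun c => ?_⟩
      rw [hc', hc]
      rcases lt_trichotomy (i / w / w) K with h | h | h
      · simp [h, h.ne, h.trans (Nat.lt_succ_self K)]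
      · simp [h]
      · simp [h.ne', h.not_gt, show ¬ i / w / w < K + 1 by omega]
  obtain ⟨g, hg, h⟩ := key K
  let u : Fin d ⊕ Fin d → ℝ → ℝ := Sum.elim (fun c x => g x (some c))
    fun c x => g x (some c) + -(2 * R)
  have hu := hg.succ (W := W) (u := u) (by simp; omega) (by
    rintro (c | c)
    · exact coord_mem_outputSpan g (some c)
    · exact Submodule.add_mem _ (coord_mem_outputSpan g (some c)) (const_mem_outputSpan g _))
  refine ⟨_, hu.mem_NNset1 (L := L) (by omega) (by omega)
    (u := fun c x => max (u (Sum.inl c) x) 0 - max (u (Sum.inr c) x) 0 + -R) fun c => ?_, ?_, ?_⟩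
  · have hc := coord_mem_outputSpan fun x k => max (u k x) 0
    exact Submodule.add_mem _ (Submodule.sub_mem _ (hc (Sum.inl c)) (hc (Sum.inr c)))
      (const_mem_outputSpan _ _)
  · intro x c
    have hR : 0 ≤ R := hR.resolve_right fun h => h.elim c
    simp only [u, Sum.elim_inl, Sum.elim_inr, abs_le]
    constructor <;> rcases max_cases (g x (some c)) 0 with h | h <;>
      rcases max_cases (g x (some c) + -(2 * R)) 0 with h' | h' <;> linarith
  · intro i hi x hx1 hx2
    obtain ⟨-, hc⟩ := h i x hx1 hx2
    ext c
    have hiK : i / w / w < K := by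
      rw [Nat.div_lt_iff_lt_mul hw0, Nat.div_lt_iff_lt_mul hw0]
      exact hi
    simp only [u, Sum.elim_inl, Sum.elim_inr, hc, if_pos hiK]
    rw [max_eq_left (hy' i c), max_eq_right (by linarith [(abs_le.1 (hy i c)).2])]
    ring

theorem exists_ereal_measure_Iic_eq (ν : Measure ℝ) [IsProbabilityMeasure ν] [NullSingletonClass ν]
    {c : ℝ≥0∞} (hc : c ≤ 1) : ∃ Q : EReal, ν (Real.toEReal ⁻¹' Iic Q) = c := by
  rcases eq_or_ne c 0 with rfl | h0
  · exact ⟨⊥, by simp [preimage]⟩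
  rcases hc.eq_or_lt with rfl | h1
  · exact ⟨⊤, by simp⟩
  have hcont : Continuous (ProbabilityTheory.cdf ν) := by
    refine continuous_iff_continuousAt.2 fun x => ?_
    rw [(ProbabilityTheory.monotone_cdf ν).continuousAt_iff_leftLim_eq_rightLim,
      StieltjesFunction.rightLim_eq]
    have h := (ProbabilityTheory.cdf ν).measure_singleton x
    rw [ProbabilityTheory.measure_cdf, measure_singleton, eq_comm, ENNReal.ofReal_eq_zero] at h
    exact le_antisymm ((ProbabilityTheory.monotone_cdf ν).leftLim_le le_rfl) (by linarith)
  have hc' : c ≠ ⊤ := h1.ne_top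
  obtain ⟨x, hx⟩ : c.toReal ∈ range (ProbabilityTheory.cdf ν) := by
    refine mem_range_of_exists_le_of_exists_ge hcont ?_ ?_
    · exact ((ProbabilityTheory.tendsto_cdf_atBot ν).eventually_le_const
        (ENNReal.toReal_pos h0 hc')).exists
    · refine ((ProbabilityTheory.tendsto_cdf_atTop ν).eventually_const_le ?_).exists
      simpa using (ENNReal.toReal_lt_toReal hc' ENNReal.one_ne_top).2 h1
  refine ⟨x, ?_⟩
  have : Real.toEReal ⁻¹' Iic (x : EReal) = Iic x := by ext; simp
  rw [this, ← ProbabilityTheory.ofReal_cdf, hx, ENNReal.ofReal_toReal hc']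

theorem exists_monotone_ereal_measure_Iic_eq (ν : Measure ℝ) [IsProbabilityMeasure ν]
    [NullSingletonClass ν] {c : ℕ → ℝ≥0∞} (hc : Monotone c) (hc1 : ∀ i, c i ≤ 1) :
    ∃ Q : ℕ → EReal, Monotone Q ∧ ∀ i, ν (Real.toEReal ⁻¹' Iic (Q i)) = c i := by
  choose h hh using fun c : Iic (1 : ℝ≥0∞) => exists_ereal_measure_Iic_eq ν c.2
  refine ⟨fun i => h ⟨c i, hc1 i⟩, fun i j hij => ?_, fun i => hh ⟨c i, hc1 i⟩⟩
  rcases (hc hij).eq_or_lt with heq | hlt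
  · simp [heq]
  · by_contra! hlt'
    refine hlt.not_ge ?_
    exact (hh ⟨c j, hc1 j⟩).symm.trans_le
      ((measure_mono (preimage_mono (Iic_subset_Iic.2 hlt'.le))).trans_eq (hh ⟨c i, hc1 i⟩))

theorem inv_smul_smul_restrict {F : Type*} [MeasurableSpace F] {κ : Measure F} {s : Set F}
    {a : ℝ≥0∞} (hs : κ s = a) (ha : a ≠ ⊤) : a⁻¹ • a • κ.restrict s = κ.restrict s := by
  rcases eq_or_ne a 0 with rfl | h
  · simp [Measure.restrict_eq_zero.2 hs]
  · rw [smul_smul, ENNReal.inv_mul_cancel h ha, one_smul]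

/-- A coupling of `μ` with a measure on the line that maps the cells of a finite measurable
partition to successive intervals. -/
theorem exists_coupling_intervals {E : Type*} [MeasurableSpace E] (μ : Measure E)
    [IsProbabilityMeasure μ] (ν : Measure ℝ) [IsProbabilityMeasure ν] [NullSingletonClass ν]
    {I : E → ℕ} (hI : Measurable I) {n : ℕ} (hIn : ∀ x, I x ≤ n) :
    ∃ (π : Measure (E × ℝ)) (Q : ℕ → EReal), π.map Prod.fst = μ ∧ π.map Prod.snd = ν ∧
      Monotone Q ∧ ∀ᵐ z ∂π, Q (I z.1) < z.2 ∧ (z.2 : EReal) < Q (I z.1 + 1) := by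
  have hmeas : Measurable Real.toEReal := measurable_coe_real_ereal
  obtain ⟨Q, hQ, hQν⟩ := exists_monotone_ereal_measure_Iic_eq ν (c := fun i => μ (I ⁻¹' Iio i))
    (fun i j hij => measure_mono (preimage_mono (Iio_subset_Iio hij))) fun i => prob_le_one
  let U (i : ℕ) : Set E := I ⁻¹' {i}
  let P (i : ℕ) : Set ℝ := Real.toEReal ⁻¹' Ioc (Q i) (Q (i + 1))
  have hU i : MeasurableSet (U i) := hI (measurableSet_singleton i)
  have hP i : MeasurableSet (P i) := hmeas measurableSet_Ioc
  have hPU i : ν (P i) = μ (U i) := by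
    have h1 : ν (Real.toEReal ⁻¹' Iic (Q (i + 1))) =
        ν (Real.toEReal ⁻¹' Iic (Q i)) + ν (P i) := by
      rw [← measure_union (Disjoint.preimage _ ?_) (hP i), ← preimage_union,
        Iic_union_Ioc_eq_Iic (hQ (Nat.le_succ i))]
      exact Iic_disjoint_Ioc le_rfl
    have h2 : μ (I ⁻¹' Iio (i + 1)) = μ (I ⁻¹' Iio i) + μ (U i) := by
      rw [← measure_union (Disjoint.preimage _ (by simp)) (hU i), ← preimage_union]
      congr 2
      ext j
      simp
    rw [hQν, hQν, h2] at h1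
    exact ((ENNReal.add_right_inj (measure_ne_top _ _)).1 h1).symm
  have hnull (i : ℕ) : ∀ᵐ t : ℝ ∂ν, (t : EReal) ≠ Q i := by
    refine measure_mono_null (t := {(Q i).toReal}) (fun t ht => ?_) (measure_singleton _)
    simp only [mem_compl_iff, mem_ofPred_eq, not_not] at ht
    simp [← ht]
  refine ⟨Measure.sum fun i => (μ (U i))⁻¹ • (μ.restrict (U i)).prod (ν.restrict (P i)), Q,
    ?_, ?_, hQ, ?_⟩
  · rw [Measure.map_sum measurable_fst.aemeasurable]
    simp only [Measure.map_smul, Measure.map_fst_prod, Measure.restrict_apply_univ, hPU]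
    simp only [inv_smul_smul_restrict (κ := μ) rfl (measure_ne_top _ _)]
    rw [← Measure.restrict_iUnion (fun i j hij => Disjoint.preimage _ (by simpa using hij)) hU,
      ← preimage_iUnion, iUnion_singleton_eq_range]
    simp
  · rw [Measure.map_sum measurable_snd.aemeasurable]
    simp only [Measure.map_smul, Measure.map_snd_prod, Measure.restrict_apply_univ]
    simp only [inv_smul_smul_restrict (hPU _) (measure_ne_top _ _)]
    have hPd : Pairwise (Function.onFun Disjoint P) := fun i j hij =>
      Disjoint.preimage _ (hQ.pairwise_disjoint_on_Ioc_succ hij)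
    rw [← Measure.restrict_iUnion hPd hP]
    refine Measure.restrict_eq_self_of_ae_mem ?_
    have h0 : ∀ᵐ t : ℝ ∂ν, Q 0 < (t : EReal) := by
      refine measure_mono_null (fun t ht => ?_) ((hQν 0).trans (by simp))
      simpa using ht
    have h1 : ∀ᵐ t : ℝ ∂ν, (t : EReal) ≤ Q (n + 1) := by
      have : ν (Real.toEReal ⁻¹' Iic (Q (n + 1))) = 1 := by
        rw [hQν]
        convert measure_univ (μ := μ)
        exact eq_univ_of_forall fun x => Nat.lt_succ_of_le (hIn x)
      exact (prob_compl_eq_zero_iff (hmeas measurableSet_Iic)).2 this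
    filter_upwards [h0, h1] with t ht0 ht1
    have hex : ∃ i, (t : EReal) ≤ Q i := ⟨_, ht1⟩
    obtain ⟨i, hi⟩ : ∃ i, Nat.find hex = i + 1 :=
      Nat.exists_eq_succ_of_ne_zero fun h => (Nat.find_spec hex).not_gt (h ▸ ht0)
    exact mem_iUnion.2 ⟨i, not_le.1 (Nat.find_min hex (by omega)), hi ▸ Nat.find_spec hex⟩
  · refine Measure.ae_sum_iff.2 fun i => Measure.ae_smul_measure ?_ _
    have hfst : ∀ᵐ z ∂(μ.restrict (U i)).prod (ν.restrict (P i)), z.1 ∈ U i :=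
      Measure.quasiMeasurePreserving_fst.ae (ae_restrict_mem (hU i))
    have hsnd : ∀ᵐ z ∂(μ.restrict (U i)).prod (ν.restrict (P i)),
        z.2 ∈ P i ∧ (z.2 : EReal) ≠ Q (i + 1) :=
      Measure.quasiMeasurePreserving_snd.ae
        ((ae_restrict_mem (hP i)).and (ae_restrict_of_ae (hnull _)))
    filter_upwards [hfst, hsnd] with z h1 h2
    have h1 : I z.1 = i := h1
    rw [h1]
    exact ⟨h2.1.1, lt_of_le_of_ne h2.1.2 h2.2⟩

/-- Truncation of an extended real number to `[-m, m]`. -/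
noncomputable def truncEReal (m : ℕ) (Q : EReal) : ℝ :=
  (max ((-m : ℝ) : EReal) (min (m : ℝ) Q)).toReal

theorem coe_truncEReal (m : ℕ) (Q : EReal) :
    (truncEReal m Q : EReal) = max ((-m : ℝ) : EReal) (min (m : ℝ) Q) := by
  refine EReal.coe_toReal (ne_of_lt ?_) (ne_of_gt ?_)
  · exact max_lt (EReal.coe_lt_top _) (min_lt_of_left_lt (EReal.coe_lt_top _))
  · exact lt_max_of_lt_left (EReal.bot_lt_coe _)

theorem monotone_truncEReal (m : ℕ) : Monotone (truncEReal m) := by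
  intro Q Q' h
  rw [← EReal.coe_le_coe_iff, coe_truncEReal, coe_truncEReal]
  gcongr

theorem eventually_truncEReal_add_le {Q : EReal} {t : ℝ} (h : Q < t) :
    ∀ᶠ m : ℕ in atTop, truncEReal m Q + 1 / ((m : ℝ) + 1) ≤ t := by
  obtain ⟨r, hr, hrt⟩ := EReal.lt_iff_exists_real_btwn.1 h
  have hrt : r < t := EReal.coe_lt_coe_iff.1 hrt
  have h1 := tendsto_one_div_add_atTop_nhds_zero_nat (𝕜 := ℝ) |>.eventually_le_const
    (sub_pos.2 hrt)
  filter_upwards [h1, eventually_ge_atTop ⌈-r⌉₊] with m hm hmr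
  have : truncEReal m Q ≤ r := by
    rw [← EReal.coe_le_coe_iff, coe_truncEReal]
    refine max_le (EReal.coe_le_coe_iff.2 ?_) ((min_le_right _ _).trans hr.le)
    linarith [Nat.ceil_le.1 hmr]
  linarith

theorem eventually_le_truncEReal_sub {Q : EReal} {t : ℝ} (h : (t : EReal) < Q) :
    ∀ᶠ m : ℕ in atTop, t ≤ truncEReal m Q - 1 / ((m : ℝ) + 1) := by
  obtain ⟨r, hrt, hr⟩ := EReal.lt_iff_exists_real_btwn.1 h
  have hrt : t < r := EReal.coe_lt_coe_iff.1 hrt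
  have h1 := tendsto_one_div_add_atTop_nhds_zero_nat (𝕜 := ℝ) |>.eventually_le_const
    (sub_pos.2 hrt)
  filter_upwards [h1, eventually_ge_atTop ⌈r⌉₊] with m hm hmr
  have : r ≤ truncEReal m Q := by
    rw [← EReal.coe_le_coe_iff, coe_truncEReal]
    exact le_max_of_le_right (le_min (EReal.coe_le_coe_iff.2 (Nat.ceil_le.1 hmr)) hr.le)
  linarith

theorem Wdist_map_le_lintegral {E : Type*} [MeasurableSpace E] [PseudoEMetricSpace E]
    [OpensMeasurableSpace E] [SecondCountableTopology E]
    {p : ℝ} (hp : 0 ≤ p) {μ : Measure E} {ν : Measure ℝ} {π : Measure (E × ℝ)}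
    (h1 : π.map Prod.fst = μ) (h2 : π.map Prod.snd = ν) {φ : ℝ → E} (hφ : Measurable φ) :
    Wdist p μ (ν.map φ) ≤ (∫⁻ z, edist z.1 (φ z.2) ^ p ∂π) ^ (1 / p) := by
  refine ENNReal.rpow_le_rpow ?_ (by positivity)
  have hm : Measurable fun z : E × ℝ => (z.1, φ z.2) := by fun_prop
  refine (iInf₂_le (π.map fun z => (z.1, φ z.2)) ⟨?_, ?_⟩).trans_eq ?_
  · rw [lintegral_map (by fun_prop) hm]
  · rw [Measure.map_map measurable_fst hm]
    exact h1
  · rw [Measure.map_map measurable_snd hm, ← h2, Measure.map_map hφ measurable_snd]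
    rfl

theorem EuclideanSpace.norm_le_of_forall_abs_le {d : ℕ} {v : EuclideanSpace ℝ (Fin d)} {R : ℝ}
    (h : ∀ c, |v c| ≤ R) : ‖v‖ ≤ √(d * R ^ 2) := by
  rw [EuclideanSpace.norm_eq]
  refine Real.sqrt_le_sqrt ((Finset.sum_le_card_nsmul _ _ (R ^ 2) fun c _ => ?_).trans_eq ?_)
  · exact pow_le_pow_left₀ (norm_nonneg _) (h c) 2
  · simp

theorem iInf_Wdist_map_le {d : ℕ} {p : ℝ} (hp : 1 ≤ p) (μ : Measure (EuclideanSpace ℝ (Fin d)))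
    [IsProbabilityMeasure μ] (ν : Measure ℝ) [IsProbabilityMeasure ν] [NullSingletonClass ν]
    {I : EuclideanSpace ℝ (Fin d) → ℕ} (hI : Measurable I) {n : ℕ} (hIn : ∀ x, I x ≤ n)
    {y : ℕ → EuclideanSpace ℝ (Fin d)} {R : ℝ} (hy : ∀ i c, |y i c| ≤ R)
    {F : Set (ℝ → EuclideanSpace ℝ (Fin d))} (hF : ∀ φ ∈ F, Measurable φ)
    (hFq : ∀ q : ℕ → ℝ, Monotone q → ∀ γ > 0, ∃ φ ∈ F, (∀ x c, |φ x c| ≤ R) ∧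
      ∀ i ≤ n, ∀ x, q i + γ ≤ x → x ≤ q (i + 1) - γ → φ x = y i) :
    ⨅ φ ∈ F, Wdist p μ (ν.map φ) ≤ (∫⁻ x, edist x (y (I x)) ^ p ∂μ) ^ (1 / p) := by
  obtain ⟨π, Q, hπ1, hπ2, hQ, hπ⟩ := exists_coupling_intervals μ ν hI hIn
  have : IsProbabilityMeasure π := by
    constructor
    rw [← preimage_univ (f := Prod.fst), ← Measure.map_apply measurable_fst .univ, hπ1,
      measure_univ]
  choose φ hφF hφR hφ using fun m : ℕ => hFq (fun i => truncEReal m (Q i))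
    (fun i j hij => monotone_truncEReal m (hQ hij)) (1 / ((m : ℝ) + 1)) (by positivity)
  have hp0 : 0 < p := by linarith
  have hyI : Measurable fun x => y (I x) := (measurable_of_countable y).comp hI
  have hφm m : Measurable (φ m) := hF _ (hφF m)
  have hlim : Tendsto (fun m => ∫⁻ z, edist (y (I z.1)) (φ m z.2) ^ p ∂π) atTop (𝓝 0) := by
    have h := tendsto_lintegral_of_dominated_convergence (μ := π)
      (F := fun m z => edist (y (I z.1)) (φ m z.2) ^ p) (f := fun _ => 0)
      (fun _ => ENNReal.ofReal (2 * √(d * R ^ 2)) ^ p) (fun m => ?_) (fun m => ?_) ?_ ?_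
    · simpa using h
    · have := hφm m
      exact ((hyI.comp measurable_fst).edist (this.comp measurable_snd)).pow_const _
    · refine Eventually.of_forall fun z => ENNReal.rpow_le_rpow ?_ hp0.le
      rw [edist_dist]
      refine ENNReal.ofReal_le_ofReal ((dist_le_norm_add_norm _ _).trans ?_)
      linarith [EuclideanSpace.norm_le_of_forall_abs_le (hy (I z.1)),
        EuclideanSpace.norm_le_of_forall_abs_le (hφR m z.2)]
    · rw [lintegral_const, measure_univ, mul_one]
      exact ENNReal.rpow_ne_top_of_nonneg hp0.le ENNReal.ofReal_ne_top
    · filter_upwards [hπ] with z hz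
      refine tendsto_const_nhds.congr' ?_
      filter_upwards [eventually_truncEReal_add_le hz.1, eventually_le_truncEReal_sub hz.2]
        with m h1 h2
      rw [hφ m _ (hIn z.1) _ h1 h2]
      simp [hp0]
  have hle (m : ℕ) : ⨅ φ ∈ F, Wdist p μ (ν.map φ) ≤
      (∫⁻ x, edist x (y (I x)) ^ p ∂μ) ^ (1 / p)
        + (∫⁻ z, edist (y (I z.1)) (φ m z.2) ^ p ∂π) ^ (1 / p) := by
    have hm1 : Measurable fun z : EuclideanSpace ℝ (Fin d) × ℝ => edist z.1 (y (I z.1)) :=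
      measurable_fst.edist (hyI.comp measurable_fst)
    have hm2 : Measurable fun z : EuclideanSpace ℝ (Fin d) × ℝ =>
        edist (y (I z.1)) (φ m z.2) :=
      (hyI.comp measurable_fst).edist ((hφm m).comp measurable_snd)
    refine (iInf₂_le _ (hφF m)).trans
      ((Wdist_map_le_lintegral hp0.le hπ1 hπ2 (hφm m)).trans ?_)
    have h := ENNReal.lintegral_Lp_add_le (μ := π) hm1.aemeasurable hm2.aemeasurable hp
    have h' : ∫⁻ x, edist x (y (I x)) ^ p ∂μ = ∫⁻ z, edist z.1 (y (I z.1)) ^ p ∂π := by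
      rw [← hπ1]
      exact lintegral_map ((measurable_id.edist hyI).pow_const _) measurable_fst
    rw [h']
    refine le_trans (ENNReal.rpow_le_rpow (lintegral_mono fun z => ?_) (by positivity)) h
    exact ENNReal.rpow_le_rpow (edist_triangle _ _ _) hp0.le
  have := (hlim.ennrpow_const (1 / p)).const_add ((∫⁻ x, edist x (y (I x)) ^ p ∂μ) ^ (1 / p))
  refine ge_of_tendsto' (by simpa [hp0] using this) hle

theorem Finset.exists_seq_isBounded {E : Type*} [SeminormedAddCommGroup E] (t : Finset E) :
    ∃ (y : ℕ → E) (R : ℝ), y 0 = 0 ∧ (∀ i, ‖y i‖ ≤ R) ∧ ∀ x ∈ t, ∃ k ≤ t.card, y k = x := by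
  refine ⟨fun i => ((0 : E) :: t.toList).getD i 0, ∑ x ∈ t, ‖x‖, rfl, fun i => ?_, fun x hx => ?_⟩
  · rcases i with _ | i
    · simp [Finset.sum_nonneg]
    change ‖t.toList.getD i 0‖ ≤ _
    by_cases hi : i < t.toList.length
    · rw [List.getD_eq_getElem _ _ hi]
      exact Finset.single_le_sum (f := fun x : E => ‖x‖) (fun x _ => norm_nonneg x)
        (Finset.mem_toList.1 (List.getElem_mem hi))
    · rw [List.getD_eq_default _ _ (not_lt.1 hi)]
      simp [Finset.sum_nonneg]
  · obtain ⟨i, hi, rfl⟩ := List.getElem_of_mem (Finset.mem_toList.2 hx)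
    refine ⟨i + 1, by simpa using hi, ?_⟩
    exact List.getD_eq_getElem _ _ hi

theorem exists_finset_of_measureCoveringNumber_le {E : Type*} [PseudoMetricSpace E]
    [MeasurableSpace E] {ε δ : ℝ} {μ : Measure E} {n : ℕ}
    (h : measureCoveringNumber ε δ μ ≤ n) :
    ∃ t : Finset E, t.card ≤ n ∧ 1 - ENNReal.ofReal δ ≤ μ (⋃ x ∈ t, ball x ε) := by
  have h : measureCoveringNumber ε δ μ < (n + 1 : ℕ) :=
    h.trans_lt (Nat.cast_lt.2 n.lt_succ_self)
  simp only [measureCoveringNumber, _root_.coveringNumber, iInf_lt_iff] at h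
  obtain ⟨S, hS, t, ht, hn⟩ := h
  exact ⟨t, Nat.lt_succ_iff.1 (Nat.cast_lt.1 hn), hS.trans (measure_mono ht)⟩

theorem ofReal_Mq {q : ℝ} (hq : 0 < q) {d : ℕ} {μ : Measure (EuclideanSpace ℝ (Fin d))}
    (hM : moment q μ ≠ ⊤) : ENNReal.ofReal (Mq q μ) = moment q μ ^ (1 / q) := by
  rw [Mq, ← ENNReal.ofReal_rpow_of_nonneg ENNReal.toReal_nonneg (by positivity),
    ENNReal.ofReal_toReal hM]

theorem Mq_nonneg (q : ℝ) {d : ℕ} (μ : Measure (EuclideanSpace ℝ (Fin d))) : 0 ≤ Mq q μ :=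
  Real.rpow_nonneg ENNReal.toReal_nonneg _

theorem setLIntegral_enorm_rpow_le {p q : ℝ} (hp : 0 < p) (hpq : p < q) {d : ℕ}
    {μ : Measure (EuclideanSpace ℝ (Fin d))} (hM : moment q μ ≠ ⊤) {ε : ℝ} (hε : 0 < ε)
    {A : Set (EuclideanSpace ℝ (Fin d))}
    (hA : μ A ≤ ENNReal.ofReal (ε ^ (p * q / (q - p)))) :
    ∫⁻ x in A, ‖x‖ₑ ^ p ∂μ ≤ ENNReal.ofReal (ε * Mq q μ) ^ p := by
  have hq : 0 < q := hp.trans hpq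
  have hqp : 0 < q - p := sub_pos.2 hpq
  have h := eLpNorm'_le_eLpNorm'_mul_rpow_measure_univ (μ := μ.restrict A) (f := id) hp hpq.le
    aestronglyMeasurable_id
  rw [← ENNReal.rpow_le_rpow_iff (one_div_pos.2 hp), one_div, ENNReal.rpow_rpow_inv hp.ne']
  simp only [eLpNorm', id, Measure.restrict_apply_univ] at h
  rw [← one_div]
  refine h.trans ?_
  rw [mul_comm, ENNReal.ofReal_mul hε.le, ofReal_Mq hq hM]
  refine mul_le_mul' ?_ (ENNReal.rpow_le_rpow ?_ (by positivity))
  · have hr : 1 / p - 1 / q = (p * q / (q - p))⁻¹ := by field_simp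
    refine (ENNReal.rpow_le_rpow hA ?_).trans_eq ?_
    · rw [hr]; positivity
    · rw [hr, ENNReal.ofReal_rpow_of_pos (by positivity), Real.rpow_rpow_inv hε.le (by positivity)]
  · refine (setLIntegral_le_lintegral _ _).trans_eq ?_
    simp [moment]

/-- Quantization of a measure by nearest point projection onto the centres of a covering. -/
theorem exists_quantization {p q : ℝ} (hp : 0 < p) (hpq : p < q) {d : ℕ}
    {μ : Measure (EuclideanSpace ℝ (Fin d))} [IsProbabilityMeasure μ] (hM : moment q μ ≠ ⊤)
    {ε : ℝ} (hε : 0 < ε) {n : ℕ}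
    (hn : measureCoveringNumber ε (ε ^ (p * q / (q - p))) μ ≤ n) :
    ∃ (I : EuclideanSpace ℝ (Fin d) → ℕ) (y : ℕ → EuclideanSpace ℝ (Fin d)) (R : ℝ),
      Measurable I ∧ (∀ x, I x ≤ n) ∧ (∀ i c, |y i c| ≤ R) ∧
      (∫⁻ x, edist x (y (I x)) ^ p ∂μ) ^ (1 / p) ≤
        ENNReal.ofReal (ε * (Mq q μ ^ p + 1) ^ (1 / p)) := by
  obtain ⟨t, htn, ht⟩ := exists_finset_of_measureCoveringNumber_le hn
  obtain ⟨y, R, hy0, hyR, hyt⟩ := t.exists_seq_isBounded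
  let I := SimpleFunc.nearestPtInd y n
  have hnear {k : ℕ} (hk : k ≤ n) (x : EuclideanSpace ℝ (Fin d)) :
      edist x (y (I x)) ≤ edist x (y k) := by
    rw [edist_comm, edist_comm x]
    exact SimpleFunc.edist_nearestPt_le y x hk
  refine ⟨I, y, R, I.measurable, fun x => SimpleFunc.nearestPtInd_le y n x,
    fun i c => (PiLp.norm_apply_le (y i) c).trans (hyR i), ?_⟩
  let G : Set (EuclideanSpace ℝ (Fin d)) := ⋃ x ∈ t, ball x ε
  have hGm : MeasurableSet G := t.measurableSet_biUnion fun x _ => measurableSet_ball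
  have hGc : μ Gᶜ ≤ ENNReal.ofReal (ε ^ (p * q / (q - p))) := by
    rw [prob_compl_eq_one_sub hGm]
    exact tsub_le_iff_tsub_le.1 ht
  have h1 : ∫⁻ x in G, edist x (y (I x)) ^ p ∂μ ≤ ENNReal.ofReal ε ^ p := by
    refine (setLIntegral_mono (g := fun _ => ENNReal.ofReal ε ^ p) measurable_const
      fun x hx => ?_).trans ?_
    · obtain ⟨v, hv, hxv⟩ := mem_iUnion₂.1 hx
      obtain ⟨k, hk, rfl⟩ := hyt v hv
      refine ENNReal.rpow_le_rpow ((hnear (hk.trans htn) x).trans ?_) hp.le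
      rw [edist_dist]
      exact ENNReal.ofReal_le_ofReal (mem_ball.1 hxv).le
    · rw [setLIntegral_const]
      exact mul_le_of_le_one_right' prob_le_one
  have h2 : ∫⁻ x in Gᶜ, edist x (y (I x)) ^ p ∂μ ≤ ENNReal.ofReal (ε * Mq q μ) ^ p := by
    refine (lintegral_mono fun x => ENNReal.rpow_le_rpow ?_ hp.le).trans
      (setLIntegral_enorm_rpow_le hp hpq hM hε hGc)
    simpa [hy0] using hnear n.zero_le x
  have hMq := Mq_nonneg q μ
  rw [← lintegral_add_compl _ hGm]
  refine (ENNReal.rpow_le_rpow (add_le_add h1 h2) (by positivity)).trans_eq ?_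
  rw [ENNReal.ofReal_rpow_of_pos hε, ENNReal.ofReal_rpow_of_nonneg (by positivity) hp.le,
    ← ENNReal.ofReal_add (by positivity) (by positivity),
    ENNReal.ofReal_rpow_of_nonneg (by positivity) (by positivity), Real.mul_rpow hε.le hMq,
    add_comm, ← mul_add_one, Real.mul_rpow (by positivity) (by positivity), one_div,
    Real.rpow_rpow_inv hε.le hp.ne']

theorem eventually_measureCoveringNumber_le {E : Type*} [PseudoMetricSpace E] [MeasurableSpace E]
    {r s : ℝ} {μ : Measure E} (hs : upperDim r μ < ENNReal.ofReal s) :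
    ∃ s' : ℝ, 0 < s' ∧ s' < s ∧ ∀ᶠ ε : ℝ in 𝓝[>] 0, ∀ n : ℕ, ε ^ (-s') ≤ n →
      measureCoveringNumber ε (ε ^ r) μ ≤ n := by
  obtain ⟨s', hs', h1, h2⟩ := ENNReal.lt_iff_exists_real_btwn.1 hs
  have hs0 : 0 < s' := by
    by_contra! h
    simp [ENNReal.ofReal_of_nonpos h] at h1
  refine ⟨s', hs0, (ENNReal.ofReal_lt_ofReal_iff_of_nonneg hs').1 h2, ?_⟩
  filter_upwards [eventually_lt_of_limsup_lt h1, Ioo_mem_nhdsGT one_pos] with ε hε hε01 n hn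
  have hlog : 0 < -Real.logb 2 ε := neg_pos.2 (Real.logb_neg one_lt_two hε01.1 hε01.2)
  rw [ENNReal.div_lt_iff (Or.inl (by simpa using hlog)) (by simp),
    ← ENNReal.ofReal_mul hs', elog2] at hε
  split_ifs at hε with htop
  · simp at hε
  obtain ⟨k, hk⟩ := ENat.ne_top_iff_exists.1 htop
  rw [← hk] at hε ⊢
  rcases k.eq_zero_or_pos with rfl | hk0
  · simp
  have hk0' : (0 : ℝ) < k := Nat.cast_pos.2 hk0
  rw [ENat.toNat_natCast, ENNReal.ofReal_lt_ofReal_iff (by positivity), mul_neg, ← neg_mul,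
    ← Real.logb_rpow_eq_mul_logb_of_pos hε01.1,
    Real.logb_lt_logb_iff one_lt_two hk0' (by have := hε01.1; positivity)] at hε
  exact Nat.cast_le.2 (Nat.cast_le.1 (hε.le.trans hn))

theorem tendsto_rpow_neg_atTop_nhdsGT {a : ℝ} (ha : 0 < a) :
    Tendsto (fun x : ℝ => x ^ (-a)) atTop (𝓝[>] 0) := by
  refine tendsto_nhdsWithin_iff.2 ⟨tendsto_rpow_neg_atTop ha, ?_⟩
  filter_upwards [eventually_gt_atTop 0] with x hx using Real.rpow_pos_of_pos hx _

theorem eventually_rpow_add_const_le {a : ℝ} (ha : a < 1) (b : ℝ) {c : ℝ} (hc : 0 < c) :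
    ∀ᶠ x : ℝ in atTop, x ^ a + b ≤ c * x := by
  have h1 : (fun x : ℝ => x ^ a) =o[atTop] fun x : ℝ => x := by
    refine (Asymptotics.isLittleO_iff_tendsto' ?_).2 ?_
    · filter_upwards [eventually_gt_atTop 0] with x hx h0 using absurd h0 hx.ne'
    · refine (tendsto_rpow_neg_atTop (sub_pos.2 ha)).congr' ?_
      filter_upwards [eventually_gt_atTop 0] with x hx
      rw [neg_sub, Real.rpow_sub_one hx.ne']
  have h := (h1.add (Asymptotics.isLittleO_const_id_atTop b)).bound hc
  filter_upwards [h, eventually_ge_atTop 0] with x hx hx0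
  simpa [abs_of_nonneg hx0] using (le_abs_self _).trans hx

theorem exists_width_depth_split {d W L : ℕ} (hd : 0 < d) (hW : 16 * d ≤ W) (hL : 8 ≤ L) :
    ∃ w K : ℕ, d + 1 + 4 * (w * (d + 1)) ≤ W ∧ 0 < w ∧ 3 * K + 2 ≤ L ∧
      W ^ 2 * L ≤ 16 * (32 * d) ^ 2 * (K * w * w) := by
  have hw0 : 0 < W / (16 * d) := Nat.div_pos hW (by omega)
  have hw1 := Nat.div_mul_le_self W (16 * d)
  have hw2 := Nat.lt_mul_div_succ W (show 0 < 16 * d by omega)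
  have hK : L ≤ 16 * (L / 8) := by omega
  generalize W / (16 * d) = w at hw0 hw1 hw2
  refine ⟨w, L / 8, by nlinarith, hw0, by omega, ?_⟩
  have hw3 : W ≤ 32 * d * w := by nlinarith
  calc W ^ 2 * L ≤ (32 * d * w) ^ 2 * (16 * (L / 8)) := by gcongr
    _ = _ := by ring

/-- Theorem: approximation of low-dimensional distributions by deep
generative networks in Wasserstein distance. -/
theorem statement2 (p q : ℝ) (d : ℕ) (hd : 0 < d) (hp : 1 ≤ p) (hpq : p < q)
    (ν : Measure ℝ) [IsProbabilityMeasure ν] (hν : ν ≪ volume)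
    (μ : Measure (EuclideanSpace ℝ (Fin d))) [IsProbabilityMeasure μ]
    (hM : moment q μ ≠ ⊤) (s : ℝ) (hs : upperDim (p * q / (q - p)) μ < ENNReal.ofReal s) :
    ∃ C : ℝ, 0 < C ∧ C ≤ 384 ∧
      ∃ W₀ L₀ : ℕ, ∀ W ≥ W₀, ∀ L ≥ L₀,
        (⨅ φ ∈ NNset1 d W L, Wdist p μ (ν.map φ)) ≤
          ENNReal.ofReal (C * (d : ℝ) ^ (1 / s) * (Mq q μ ^ p + 1) ^ (1 / p) *
            ((W ^ 2 * L : ℕ) : ℝ) ^ (-1 / s)) := by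
  obtain ⟨s', ht0, hts, hcov⟩ := eventually_measureCoveringNumber_le hs
  have hs0 : 0 < s := ht0.trans hts
  have : NullSingletonClass ν := ⟨fun x => hν (measure_singleton x)⟩
  obtain ⟨X₀, hX₀⟩ := eventually_atTop.1 (((tendsto_rpow_neg_atTop_nhdsGT
    (one_div_pos.2 hs0)).eventually hcov).and ((eventually_gt_atTop 0).and
    (eventually_rpow_add_const_le ((div_lt_one hs0).2 hts) 2
      (c := 1 / (16 * (32 * d) ^ 2)) (by positivity))))
  refine ⟨1, one_pos, by norm_num, max (16 * d) ⌈X₀⌉₊, 8, fun W hW L hL => ?_⟩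
  obtain ⟨w, K, hw, hw0, hK, hX⟩ := exists_width_depth_split hd (le_of_max_le_left hW) hL
  have hWL : W ≤ W ^ 2 * L := by
    rw [sq, mul_assoc]
    exact Nat.le_mul_of_pos_right _ (mul_pos (by omega) (by omega))
  generalize hXN : W ^ 2 * L = N at hX hWL ⊢
  obtain ⟨hN1, hN0, hN2⟩ := hX₀ N
    ((Nat.le_ceil _).trans (Nat.cast_le.2 ((le_of_max_le_right hW).trans hWL)))
  have hε : (0 : ℝ) < (N : ℝ) ^ (-(1 / s)) := Real.rpow_pos_of_pos hN0 _
  have hn := hN1 ⌈(N : ℝ) ^ (s' / s)⌉₊ (by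
    rw [← Real.rpow_mul hN0.le, neg_mul_neg, one_div_mul_eq_div]
    exact Nat.le_ceil _)
  obtain ⟨I, y, R, hI, hIn, hyR, hle⟩ := exists_quantization (by linarith) hpq hM hε hn
  have hnK : ⌈(N : ℝ) ^ (s' / s)⌉₊ < K * w * w := by
    have h1 := Nat.ceil_lt_add_one (Real.rpow_nonneg hN0.le (s' / s))
    have h2 : (N : ℝ) ≤ 16 * (32 * d) ^ 2 * (K * w * w : ℕ) := by exact_mod_cast hX
    rw [one_div_mul_eq_div, le_div_iff₀ (by positivity)] at hN2
    have h3 : (N : ℝ) ^ (s' / s) + 2 ≤ (K * w * w : ℕ) := by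
      exact le_of_mul_le_mul_right (hN2.trans (h2.trans_eq (mul_comm _ _))) (by positivity)
    exact (Nat.cast_lt (α := ℝ)).1 (by linarith)
  refine (iInf_Wdist_map_le hp μ ν hI hIn hyR
    (fun φ hφ => (continuous_of_mem_NNset1 hφ).measurable) fun q hq γ hγ => ?_).trans
    (hle.trans (ENNReal.ofReal_le_ofReal ?_))
  · obtain ⟨φ, hφ, hφR, h⟩ := exists_mem_NNset1_eq_on_steps hw hw0 (by omega) hK hq hγ hyR
    exact ⟨φ, hφ, hφR, fun i hi => h i (hi.trans_lt hnK)⟩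
  · rw [neg_div, one_mul, mul_comm]
    have hd1 : 1 ≤ (d : ℝ) ^ (1 / s) :=
      Real.one_le_rpow (Nat.one_le_cast.2 hd) (one_div_pos.2 hs0).le
    have hMq := Mq_nonneg q μ
    gcongr
    exact le_mul_of_one_le_left (by positivity) hd1
end
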